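/- arXiv:1109.3610 — 3 statements merged into one kernel-verified Lean document; each statement's English description precedes it below -/
import Mathlib

section
/- Let X be a set of 11 distinct points of P^2 with generic Hilbert function. If H_{2X}(6) = 27, then H_{2X}(7) ≥ 31; equivalently, if dim_k (I_{2X})_6 = 1 then dim_k (I_{2X})_7 ≤ 5. -/
open MvPolynomial

/-- The vanishing (prime) ideal of a point of ℙ²: the ideal generated by the
linear forms vanishing at the point. -/
noncomputable def pointIdeal (k : Type) [Field k] (P : Projectivization k (Fin 3 → k)) :
    Ideal (MvPolynomial (Fin 3) k) :=
  Ideal.span {f : MvPolynomial (Fin 3) k | f.IsHomogeneous 1 ∧ eval P.rep f = 0}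

/-- The Hilbert function of R/I: H(t) = dim_k R_t − dim_k I_t. -/
noncomputable def hilbertFunction (k : Type) [Field k]
    (I : Ideal (MvPolynomial (Fin 3) k)) (t : ℕ) : ℕ :=
  Module.finrank k ↥(homogeneousSubmodule (Fin 3) k t) -
    Module.finrank k ↥(Submodule.restrictScalars k I ⊓ homogeneousSubmodule (Fin 3) k t)

/-- The defining ideal `I_X` of a finite set of points. -/
noncomputable def idealOfPoints (k : Type) [Field k] {s : ℕ}
    (P : Fin s → Projectivization k (Fin 3 → k)) : Ideal (MvPolynomial (Fin 3) k) :=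
  ⨅ i, pointIdeal k (P i)

/-- The defining ideal `I_{2X}` of the double point scheme supported on a finite set of points. -/
noncomputable def doubleIdealOfPoints (k : Type) [Field k] {s : ℕ}
    (P : Fin s → Projectivization k (Fin 3 → k)) : Ideal (MvPolynomial (Fin 3) k) :=
  ⨅ i, (pointIdeal k (P i)) ^ 2

/-- `X` has generic Hilbert function: `H_X(t) = min {s, binom(t+2,2)}` for all `t`. -/
def HasGenericHilbertFunction (k : Type) [Field k] {s : ℕ}
    (P : Fin s → Projectivization k (Fin 3 → k)) : Prop :=
  ∀ t : ℕ, hilbertFunction k (idealOfPoints k P) t = min s (Nat.choose (t + 2) 2)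

section Homogeneous

variable {k : Type} [Field k]

instance finiteDimensional_homogeneousSubmodule (t : ℕ) :
    FiniteDimensional k (homogeneousSubmodule (Fin 3) k t) :=
  Module.Finite.iff_fg.mpr (homogeneousSubmodule_fg (Fin 3) k t)

theorem finrank_homogeneousSubmodule_fin_three (t : ℕ) :
    Module.finrank k (homogeneousSubmodule (Fin 3) k t) = (t + 2).choose 2 := by
  classical
  have hset : {d : Fin 3 →₀ ℕ | d.degree = t} =
      ((Finset.univ : Finset (Fin 3)).finsuppAntidiag t : Set (Fin 3 →₀ ℕ)) := by
    ext d
    simp [Finset.mem_finsuppAntidiag, Finsupp.degree_eq_sum]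
  have hspan : homogeneousSubmodule (Fin 3) k t =
      Submodule.span k (Set.range fun d : (Finset.univ : Finset (Fin 3)).finsuppAntidiag t =>
        (basisMonomials (Fin 3) k) d) := by
    rw [homogeneousSubmodule_eq_finsupp_supported, AddMonoidAlgebra.supported_eq_span_single,
      hset]
    congr 1
    ext f
    simp [MvPolynomial.single_eq_monomial]
  rw [hspan]
  refine (finrank_span_eq_card
    ((basisMonomials (Fin 3) k).linearIndependent.comp _ Subtype.val_injective)).trans ?_
  simp only [Fintype.card_coe, Finset.card_finsuppAntidiag_nat_eq_choose, Finset.card_univ,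
    Fintype.card_fin]
  rw [show 3 + t - 1 = t + 2 by omega, ← Nat.choose_symm (by omega : 2 ≤ t + 2)]
  congr 1

/-- The grading homomorphism `f ↦ ∑ d, f_d T ^ d`. -/
noncomputable def gradingHom : MvPolynomial (Fin 3) k →ₐ[k] Polynomial (MvPolynomial (Fin 3) k) :=
  aeval fun i => Polynomial.C (X i) * Polynomial.X

theorem gradingHom_of_isHomogeneous {f : MvPolynomial (Fin 3) k} {n : ℕ}
    (hf : f.IsHomogeneous n) : gradingHom f = Polynomial.C f * Polynomial.X ^ n := by
  rw [gradingHom, aeval_def, eval₂_eq']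
  conv_rhs => rw [← aeval_X_left_apply f, aeval_def, eval₂_eq', map_sum, Finset.sum_mul]
  refine Finset.sum_congr rfl fun d hd => ?_
  have hdeg : ∑ i, d i = n := by
    rw [← Finsupp.degree_eq_sum, Finsupp.degree_eq_weight_one]
    exact hf (mem_support_iff.mp hd)
  simp only [mul_pow, Finset.prod_mul_distrib, Finset.prod_pow_eq_pow_sum, hdeg, map_mul,
    map_prod, map_pow, mul_assoc]
  congr 1

theorem coeff_gradingHom (f : MvPolynomial (Fin 3) k) (d : ℕ) :
    (gradingHom f).coeff d = homogeneousComponent d f := by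
  conv_lhs => rw [← sum_homogeneousComponent f]
  rw [map_sum, Polynomial.finsetSum_coeff]
  have : ∀ i, (gradingHom (homogeneousComponent i f)).coeff d =
      if d = i then homogeneousComponent i f else 0 := fun i => by
    rw [gradingHom_of_isHomogeneous (homogeneousComponent_isHomogeneous i f),
      Polynomial.coeff_C_mul_X_pow]
  simp only [this]
  rw [Finset.sum_ite_eq]
  split_ifs with h
  · rfl
  · exact (homogeneousComponent_eq_zero _ _ (by simpa using h)).symm

theorem isHomogeneous_of_mul {f g : MvPolynomial (Fin 3) k} {n : ℕ}
    (h : (f * g).IsHomogeneous n) (h0 : f * g ≠ 0) :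
    f.IsHomogeneous f.totalDegree ∧ f.totalDegree + g.totalDegree = n := by
  have hf0 := left_ne_zero_of_mul h0
  have hg0 := right_ne_zero_of_mul h0
  refine ⟨?_, by rw [← totalDegree_mul_of_isDomain hf0 hg0, h.totalDegree h0]⟩
  have hinj : Function.Injective (gradingHom (k := k)) := by
    refine (injective_iff_map_eq_zero _).mpr fun p hp => ?_
    rw [← sum_homogeneousComponent p]
    exact Finset.sum_eq_zero fun i _ => by rw [← coeff_gradingHom, hp, Polynomial.coeff_zero]
  have hF : gradingHom f ≠ 0 := (map_ne_zero_iff _ hinj).mpr hf0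
  have hG : gradingHom g ≠ 0 := (map_ne_zero_iff _ hinj).mpr hg0
  have hprod : gradingHom f * gradingHom g = Polynomial.C (f * g) * Polynomial.X ^ n := by
    rw [← map_mul, gradingHom_of_isHomogeneous h]
  have h1 := Polynomial.natDegree_mul hF hG
  have h2 := Polynomial.natTrailingDegree_mul hF hG
  rw [hprod, Polynomial.natDegree_C_mul_X_pow _ _ h0] at h1
  rw [hprod, Polynomial.C_mul_X_pow_eq_monomial, Polynomial.natTrailingDegree_monomial h0] at h2
  have h3 := Polynomial.natTrailingDegree_le_natDegree (gradingHom f)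
  have h4 := Polynomial.natTrailingDegree_le_natDegree (gradingHom g)
  have hcomp : ∀ d, d ≠ (gradingHom f).natDegree → homogeneousComponent d f = 0 := by
    intro d hd
    rw [← coeff_gradingHom]
    rcases lt_or_gt_of_ne hd with hlt | hgt
    · exact Polynomial.coeff_eq_zero_of_lt_natTrailingDegree (by omega)
    · exact Polynomial.coeff_eq_zero_of_natDegree_lt hgt
  have hfh : f.IsHomogeneous (gradingHom f).natDegree := by
    rw [← sum_homogeneousComponent f]
    refine IsHomogeneous.sum _ _ _ fun i _ => ?_
    rw [sum_homogeneousComponent f]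
    by_cases hi : i = (gradingHom f).natDegree
    · rw [← hi]
      exact homogeneousComponent_isHomogeneous i f
    · rw [hcomp i hi]
      exact isHomogeneous_zero _ _ _
  rwa [hfh.totalDegree hf0]

end Homogeneous

section Points

variable {k : Type} [Field k]

/-- `f` vanishes to order at least two at `v`. -/
def IsSingularAt (v : Fin 3 → k) (f : MvPolynomial (Fin 3) k) : Prop :=
  eval v f = 0 ∧ ∀ i, eval v (pderiv i f) = 0

theorem taylor_sub_mem_sq (I : Ideal (MvPolynomial (Fin 3) k))
    (a m : Fin 3 → MvPolynomial (Fin 3) k) (hm : ∀ i, m i ∈ I) (f : MvPolynomial (Fin 3) k) :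
    aeval (fun i => a i + m i) f - aeval a f - ∑ i, m i * aeval a (pderiv i f) ∈ I ^ 2 := by
  induction f using MvPolynomial.induction_on with
  | C c => simp
  | add p q hp hq =>
    have := add_mem hp hq
    simp only [map_add, mul_add, Finset.sum_add_distrib]
    convert this using 1
    ring
  | mul_X p n hp =>
    have hL : ∑ i, m i * aeval a (pderiv i p) ∈ I :=
      sum_mem fun i _ => I.mul_mem_right _ (hm i)
    have hsum : ∑ i, m i * aeval a (pderiv i (p * X n)) =
        (∑ i, m i * aeval a (pderiv i p)) * a n + aeval a p * m n := by
      simp only [pderiv_mul, map_add, map_mul, aeval_X, mul_add, Finset.sum_add_distrib,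
        Finset.sum_mul, pderiv_X]
      congr 1
      · exact Finset.sum_congr rfl fun i _ => by ring
      · rw [Finset.sum_eq_single n]
        · simp [mul_comm]
        · intro i _ hi
          simp [hi.symm]
        · simp
    rw [hsum, map_mul, map_mul, aeval_X, aeval_X]
    have h1 := add_mem ((I ^ 2).mul_mem_right (a n + m n) hp)
      (pow_two I ▸ Ideal.mul_mem_mul hL (hm n))
    convert h1 using 1
    ring

theorem eval_eq_zero_of_mem_pointIdeal (P : Projectivization k (Fin 3 → k))
    {f : MvPolynomial (Fin 3) k} (hf : f ∈ pointIdeal k P) : eval P.rep f = 0 := by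
  have : pointIdeal k P ≤ RingHom.ker (eval P.rep) := by
    rw [pointIdeal, Ideal.span_le]
    exact fun g hg => hg.2
  exact this hf

theorem isSingularAt_of_mem_pointIdeal_sq (P : Projectivization k (Fin 3 → k))
    {f : MvPolynomial (Fin 3) k} (hf : f ∈ pointIdeal k P ^ 2) : IsSingularAt P.rep f := by
  rw [pow_two] at hf
  refine Submodule.mul_induction_on hf (fun a ha b hb => ?_) fun a b ha hb => ?_
  · have ha := eval_eq_zero_of_mem_pointIdeal P ha
    have hb := eval_eq_zero_of_mem_pointIdeal P hb
    exact ⟨by simp [ha], fun i => by simp [ha, hb]⟩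
  · exact ⟨by simp [ha.1, hb.1], fun i => by simp [ha.2, hb.2]⟩

theorem aeval_C_mul_X_of_isHomogeneous (v : Fin 3 → k) (j : Fin 3)
    {f : MvPolynomial (Fin 3) k} {t : ℕ} (hf : f.IsHomogeneous t) :
    aeval (fun i => C (v i) * X j : Fin 3 → MvPolynomial (Fin 3) k) f = C (eval v f) * X j ^ t := by
  rw [aeval_def, eval₂_eq', eval_eq', map_sum, Finset.sum_mul]
  refine Finset.sum_congr rfl fun d hd => ?_
  have hdeg : ∑ i, d i = t := by
    rw [← Finsupp.degree_eq_sum, Finsupp.degree_eq_weight_one]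
    exact hf (mem_support_iff.mp hd)
  simp only [mul_pow, Finset.prod_mul_distrib, Finset.prod_pow_eq_pow_sum, hdeg, map_mul,
    map_prod, map_pow, mul_assoc, algebraMap_eq]

theorem aeval_C_mul_X_left (c : k) {f : MvPolynomial (Fin 3) k} {t : ℕ} (hf : f.IsHomogeneous t) :
    aeval (fun i => C c * X i : Fin 3 → MvPolynomial (Fin 3) k) f = C (c ^ t) * f := by
  conv_rhs => rw [← aeval_X_left_apply f, aeval_def, eval₂_eq', Finset.mul_sum]
  rw [aeval_def, eval₂_eq']
  refine Finset.sum_congr rfl fun d hd => ?_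
  have hdeg : ∑ i, d i = t := by
    rw [← Finsupp.degree_eq_sum, Finsupp.degree_eq_weight_one]
    exact hf (mem_support_iff.mp hd)
  simp only [mul_pow, Finset.prod_mul_distrib, Finset.prod_pow_eq_pow_sum, hdeg, map_pow]
  ring

theorem exists_taylor_pointIdeal (P : Projectivization k (Fin 3 → k)) {t : ℕ} :
    ∃ (c : k) (j : Fin 3) (m : Fin 3 → MvPolynomial (Fin 3) k), c ≠ 0 ∧
      (∀ i, m i ∈ pointIdeal k P) ∧ ∀ f : MvPolynomial (Fin 3) k, f.IsHomogeneous t →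
      C c * f - C (eval P.rep f) * X j ^ t -
        ∑ i, m i * (C (eval P.rep (pderiv i f)) * X j ^ (t - 1)) ∈ pointIdeal k P ^ 2 := by
  obtain ⟨j, hj⟩ := Function.ne_iff.mp P.rep_nonzero
  set v := P.rep
  let m : Fin 3 → MvPolynomial (Fin 3) k := fun i => C (v j) * X i - C (v i) * X j
  have hm : ∀ i, m i ∈ pointIdeal k P := fun i => by
    refine Ideal.subset_span ⟨?_, ?_⟩
    · exact (isHomogeneous_C_mul_X _ _).sub (isHomogeneous_C_mul_X _ _)
    · simp [m, v, mul_comm]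
  refine ⟨v j ^ t, j, m, pow_ne_zero _ hj, hm, fun f hf => ?_⟩
  have := taylor_sub_mem_sq _ (fun i => C (v i) * X j) m hm f
  simp only [m, add_sub_cancel, aeval_C_mul_X_left _ hf,
    aeval_C_mul_X_of_isHomogeneous v j hf] at this
  simpa only [m, aeval_C_mul_X_of_isHomogeneous v j hf.pderiv] using this

theorem mem_of_C_mul_mem {I : Ideal (MvPolynomial (Fin 3) k)} {c : k} (hc : c ≠ 0)
    {f : MvPolynomial (Fin 3) k} (h : C c * f ∈ I) : f ∈ I := by
  have := I.mul_mem_left (C c⁻¹) h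
  rwa [← mul_assoc, ← C_mul, inv_mul_cancel₀ hc, C_1, one_mul] at this

theorem mem_pointIdeal_of_eval_eq_zero (P : Projectivization k (Fin 3 → k))
    {f : MvPolynomial (Fin 3) k} {t : ℕ} (hf : f.IsHomogeneous t) (h : eval P.rep f = 0) :
    f ∈ pointIdeal k P := by
  obtain ⟨c, j, m, hc, hm, H⟩ := exists_taylor_pointIdeal P (t := t)
  have h1 := Ideal.pow_le_self two_ne_zero (H f hf)
  have h2 : ∑ i, m i * (C (eval P.rep (pderiv i f)) * X j ^ (t - 1)) ∈ pointIdeal k P :=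
    sum_mem fun i _ => Ideal.mul_mem_right _ _ (hm i)
  have h3 := add_mem h1 h2
  rw [sub_add_cancel, h, C_0, zero_mul, sub_zero] at h3
  exact mem_of_C_mul_mem hc h3

theorem mem_pointIdeal_sq_of_isSingularAt (P : Projectivization k (Fin 3 → k))
    {f : MvPolynomial (Fin 3) k} {t : ℕ} (hf : f.IsHomogeneous t) (h : IsSingularAt P.rep f) :
    f ∈ pointIdeal k P ^ 2 := by
  obtain ⟨c, j, m, hc, hm, H⟩ := exists_taylor_pointIdeal P (t := t)
  have h1 := H f hf
  simp only [h.1, h.2, C_0, zero_mul, mul_zero, Finset.sum_const_zero, sub_zero] at h1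
  exact mem_of_C_mul_mem hc h1

end Points

section LinearAlgebra

variable {k : Type} [Field k]

theorem finrank_inf_iInf_ker_add_sum {E ι : Type*} [AddCommGroup E] [Module k E] [Fintype ι]
    [DecidableEq ι] {M : ι → Type*} [∀ i, AddCommGroup (M i)] [∀ i, Module k (M i)]
    [∀ i, FiniteDimensional k (M i)] (V : Submodule k E) [FiniteDimensional k V]
    (L : ∀ i, E →ₗ[k] M i)
    (hsurj : ∀ i y, ∃ f ∈ V, L i f = y ∧ ∀ j, j ≠ i → L j f = 0) :
    Module.finrank k ↥(V ⊓ ⨅ i, LinearMap.ker (L i)) + ∑ i, Module.finrank k (M i) =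
      Module.finrank k V := by
  let T : V →ₗ[k] (∀ i, M i) := (LinearMap.pi L).domRestrict V
  have hT : LinearMap.range T = ⊤ := by
    rw [LinearMap.range_eq_top]
    intro y
    choose f hf hfi hfj using fun i => hsurj i (y i)
    refine ⟨∑ i, ⟨f i, hf i⟩, ?_⟩
    ext j
    simp only [T, map_sum, LinearMap.domRestrict_apply, Finset.sum_apply, LinearMap.pi_apply]
    rw [Finset.sum_eq_single j (fun i _ hij => hfj i j hij.symm) (by simp), hfi]
  have hker : (LinearMap.ker T).map V.subtype = V ⊓ ⨅ i, LinearMap.ker (L i) := by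
    rw [← Submodule.map_comap_subtype, ← LinearMap.ker_pi]
    rfl
  have := T.finrank_range_add_finrank_ker
  rw [hT, finrank_top, Module.finrank_pi_fintype] at this
  rw [← hker, Submodule.finrank_map_subtype_eq, add_comm]
  exact this

theorem finrank_le_of_forall_mul {A : Type*} [CommRing A] [IsDomain A] [Algebra k A]
    {D : A} {V W : Submodule k A} [FiniteDimensional k W]
    (h : ∀ f ∈ V, ∃ g ∈ W, f = D * g) : Module.finrank k V ≤ Module.finrank k W := by
  have hle : V ≤ W.map (LinearMap.mulLeft k D) := fun f hf => by
    obtain ⟨g, hg, rfl⟩ := h f hf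
    exact ⟨g, hg, rfl⟩
  exact (Submodule.finrank_mono hle).trans (Submodule.finrank_map_le _ _)

theorem finrank_map_mulLeft {A : Type*} [CommRing A] [IsDomain A] [Algebra k A]
    {D : A} (hD : D ≠ 0) (W : Submodule k A) :
    Module.finrank k (W.map (LinearMap.mulLeft k D)) = Module.finrank k W :=
  (Submodule.equivMapOfInjective _ (mul_right_injective₀ hD) W).finrank_eq.symm

end LinearAlgebra

section Bezout

variable {k : Type} [Field k]

theorem two_mul_choose_add_two (n : ℕ) : 2 * (n + 2).choose 2 = (n + 2) * (n + 1) := by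
  rw [Nat.choose_two_right]
  exact Nat.mul_div_cancel' (by simpa using (Nat.even_mul_pred_self (n + 2)).two_dvd)

theorem isHomogeneous_of_mul_left {f g : MvPolynomial (Fin 3) k} {m n : ℕ}
    (h : (f * g).IsHomogeneous (m + n)) (hf : f.IsHomogeneous m) (hf0 : f ≠ 0) :
    g.IsHomogeneous n := by
  by_cases hg : g = 0
  · rw [hg]; exact isHomogeneous_zero _ _ _
  have h1 := isHomogeneous_of_mul h (mul_ne_zero hf0 hg)
  have h2 := isHomogeneous_of_mul (f := g) (g := f) (mul_comm f g ▸ h) (mul_ne_zero hg hf0)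
  have h3 := hf.totalDegree hf0
  rw [show n = g.totalDegree by omega]
  exact h2.1

/-- The linear functionals on `R_(N+p+q)` killing multiples of two coprime forms of degrees `p`
and `q` span a space of dimension at most `p * q`. -/
theorem finrank_le_finrank_add_mul {F G : MvPolynomial (Fin 3) k} {p q : ℕ}
    (hF : F.IsHomogeneous p) (hF0 : F ≠ 0) (hG0 : G ≠ 0)
    (hFG : IsRelPrime F G) (N : ℕ) (U : Submodule k (MvPolynomial (Fin 3) k))
    (hUle : U ≤ homogeneousSubmodule (Fin 3) k (N + p + q))
    (hUF : ∀ g, g.IsHomogeneous (N + q) → F * g ∈ U)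
    (hUG : ∀ g, g.IsHomogeneous (N + p) → G * g ∈ U) :
    Module.finrank k (homogeneousSubmodule (Fin 3) k (N + p + q)) ≤
      Module.finrank k U + p * q := by
  have : FiniteDimensional k U := Submodule.finiteDimensional_of_le hUle
  let V₁ := (homogeneousSubmodule (Fin 3) k (N + q)).map (LinearMap.mulLeft k F)
  let V₂ := (homogeneousSubmodule (Fin 3) k (N + p)).map (LinearMap.mulLeft k G)
  let V₃ := (homogeneousSubmodule (Fin 3) k N).map (LinearMap.mulLeft k (F * G))
  have hinf : V₁ ⊓ V₂ ≤ V₃ := by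
    rintro _ ⟨⟨a, ha, rfl⟩, ⟨b, hb, hab⟩⟩
    simp only [LinearMap.mulLeft_apply] at hab ⊢
    obtain ⟨c, rfl⟩ : F ∣ b := hFG.dvd_of_dvd_mul_left ⟨a, hab⟩
    refine ⟨c, ?_, ?_⟩
    · exact isHomogeneous_of_mul_left (m := p) (by rw [add_comm]; exact hb) hF hF0
    · simp only [LinearMap.mulLeft_apply]
      rw [← hab]; ring
  have hsup : V₁ ⊔ V₂ ≤ U := by
    refine sup_le ?_ ?_
    · rintro _ ⟨a, ha, rfl⟩; exact hUF a ha
    · rintro _ ⟨a, ha, rfl⟩; exact hUG a ha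
  have h1 := Submodule.finrank_sup_add_finrank_inf_eq V₁ V₂
  have h2 := Submodule.finrank_mono hinf
  have h3 := Submodule.finrank_mono hsup
  rw [finrank_map_mulLeft hF0, finrank_map_mulLeft hG0] at h1
  rw [finrank_map_mulLeft (mul_ne_zero hF0 hG0)] at h2
  simp only [finrank_homogeneousSubmodule_fin_three] at *
  have e1 := two_mul_choose_add_two (N + q)
  have e2 := two_mul_choose_add_two (N + p)
  have e3 := two_mul_choose_add_two N
  have e4 := two_mul_choose_add_two (N + p + q)
  nlinarith

/-- There is a space of `m` functionals, supported on the second infinitesimal neighbourhood of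
`v`, that kills the ideal `(F, G)` and is independent on quadrics: a witness for the intersection
multiplicity of `F` and `G` at `v` being at least `m`. -/
def MeetsToOrder (v : Fin 3 → k) (F G : MvPolynomial (Fin 3) k) (m : ℕ) : Prop :=
  ∃ L : MvPolynomial (Fin 3) k →ₗ[k] (Fin m → k),
    (∀ y, ∃ g : MvPolynomial (Fin 3) k, g.IsHomogeneous 2 ∧ L g = y) ∧
    (∀ h g, eval v h ≠ 0 → L (h * g) = 0 → L g = 0) ∧
    (∀ l g, eval v l = 0 → L (l ^ 3 * g) = 0) ∧
    (∀ g, L (F * g) = 0) ∧ ∀ g, L (G * g) = 0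

/-- A finite family of vectors that represent distinct points of the plane. -/
def AreSeparated {ι : Type} (v : ι → Fin 3 → k) : Prop :=
  (∀ i, v i ≠ 0) ∧ ∀ i j, i ≠ j → ∃ l : MvPolynomial (Fin 3) k,
    l.IsHomogeneous 1 ∧ eval (v j) l = 0 ∧ eval (v i) l ≠ 0

theorem exists_linear_eval_ne_zero {v : Fin 3 → k} (hv : v ≠ 0) :
    ∃ l : MvPolynomial (Fin 3) k, l.IsHomogeneous 1 ∧ eval v l ≠ 0 := by
  obtain ⟨j, hj⟩ := Function.ne_iff.mp hv
  exact ⟨X j, isHomogeneous_X _ _, by simpa using hj⟩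

theorem sum_le_mul_of_meetsToOrder {ι : Type} [Fintype ι] [DecidableEq ι] {v : ι → Fin 3 → k}
    (hv : AreSeparated v)
    {F G : MvPolynomial (Fin 3) k} {p q : ℕ}
    (hF : F.IsHomogeneous p) (hG : G.IsHomogeneous q) (hF0 : F ≠ 0) (hG0 : G ≠ 0)
    (hFG : IsRelPrime F G) (m : ι → ℕ) (hm : ∀ i, MeetsToOrder (v i) F G (m i)) :
    ∑ i, m i ≤ p * q := by
  choose L hL2 hLu hL3 hLF hLG using hm
  choose l hl hlj hli using hv.2
  choose x hx hxi using fun i => exists_linear_eval_ne_zero (hv.1 i)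
  let N := (Fintype.card ι - 1) * 3 + 2
  let H : ι → MvPolynomial (Fin 3) k := fun i =>
    (∏ j : {j // j ≠ i}, l i j j.2.symm ^ 3) * x i ^ (p + q)
  have hHhom : ∀ i, (H i).IsHomogeneous ((Fintype.card ι - 1) * 3 + (p + q)) := fun i => by
    have h1 := IsHomogeneous.prod Finset.univ (fun j : {j // j ≠ i} => l i j j.2.symm ^ 3)
      (fun _ => 1 * 3) fun j _ => (hl i j j.2.symm).pow 3
    simp only [Finset.sum_const, Finset.card_univ, Fintype.card_subtype_compl,
      Fintype.card_unique, smul_eq_mul, one_mul] at h1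
    simpa using h1.mul ((hx i).pow (p + q))
  have hHi : ∀ i, eval (v i) (H i) ≠ 0 := fun i => by
    simp only [H, map_mul, map_prod, map_pow]
    exact mul_ne_zero (Finset.prod_ne_zero_iff.mpr fun j _ => pow_ne_zero _ (hli i j _))
      (pow_ne_zero _ (hxi i))
  have hHj : ∀ i j g, j ≠ i → L j (H i * g) = 0 := fun i j g hji => by
    simp only [H]
    rw [Fintype.prod_eq_mul_prod_compl ⟨j, hji⟩, mul_assoc, mul_assoc]
    exact hL3 _ _ _ (hlj i j _)
  have hsurj : ∀ i y, ∃ f ∈ homogeneousSubmodule (Fin 3) k (N + p + q), L i f = y ∧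
      ∀ j, j ≠ i → L j f = 0 := by
    intro i y
    let V := homogeneousSubmodule (Fin 3) k 2
    let A : V →ₗ[k] (Fin (m i) → k) := (L i).domRestrict V
    let B : V →ₗ[k] (Fin (m i) → k) := (L i ∘ₗ LinearMap.mulLeft k (H i)).domRestrict V
    have hA : LinearMap.range A = ⊤ := LinearMap.range_eq_top.mpr fun z => by
      obtain ⟨g, hg, hgz⟩ := hL2 i z
      exact ⟨⟨g, hg⟩, hgz⟩
    have hker : LinearMap.ker B ≤ LinearMap.ker A := fun g hg => hLu i _ _ (hHi i) hg
    have hB : LinearMap.range B = ⊤ := by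
      apply Submodule.eq_top_of_finrank_eq
      have h1 := A.finrank_range_add_finrank_ker
      have h2 := B.finrank_range_add_finrank_ker
      have h3 := Submodule.finrank_mono hker
      have h4 := Submodule.finrank_le (LinearMap.range B)
      rw [hA, finrank_top] at h1
      omega
    obtain ⟨⟨g, hg⟩, hgy⟩ := LinearMap.range_eq_top.mp hB y
    refine ⟨H i * g, ?_, hgy, fun j hj => hHj i j g hj⟩
    have := (hHhom i).mul hg
    rw [mem_homogeneousSubmodule]
    convert this using 1
    simp only [N]; ring
  have hrank := finrank_inf_iInf_ker_add_sum (homogeneousSubmodule (Fin 3) k (N + p + q)) L hsurj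
  have hle := finrank_le_finrank_add_mul (q := q) hF hF0 hG0 hFG N
    (homogeneousSubmodule (Fin 3) k (N + p + q) ⊓ ⨅ i, LinearMap.ker (L i)) inf_le_left ?_ ?_
  · simp only [Module.finrank_fin_fun] at hrank
    omega
  · intro g hg
    refine ⟨?_, by simpa using fun i => hLF i g⟩
    have := hF.mul hg
    rw [SetLike.mem_coe, mem_homogeneousSubmodule]
    convert this using 1
    ring
  · intro g hg
    refine ⟨?_, by simpa using fun i => hLG i g⟩
    have := hG.mul hg
    rw [SetLike.mem_coe, mem_homogeneousSubmodule]
    convert this using 1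
    ring

theorem meetsToOrder_zero (v : Fin 3 → k) (F G : MvPolynomial (Fin 3) k) :
    MeetsToOrder v F G 0 :=
  ⟨0, fun _ => ⟨0, isHomogeneous_zero _ _ _, Subsingleton.elim _ _⟩,
    by simp, by simp, by simp, by simp⟩

theorem meetsToOrder_one {v : Fin 3 → k} (hv : v ≠ 0) {F G : MvPolynomial (Fin 3) k}
    (hF : eval v F = 0) (hG : eval v G = 0) : MeetsToOrder v F G 1 := by
  obtain ⟨l, hl, hlv⟩ := exists_linear_eval_ne_zero hv
  refine ⟨⟨⟨fun f => ![eval v f], fun f g => by simp⟩, fun c f => by simp [smul_eq_C_mul]⟩,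
    fun y => ⟨C (y 0 / (eval v l) ^ 2) * l ^ 2, (hl.pow 2).C_mul _, ?_⟩, ?_, ?_, ?_, ?_⟩
  · ext i; fin_cases i; simp [hlv]
  · intro h g hh hg
    simpa [hh] using hg
  · intro l g hl; simp [hl]
  · intro g; simp [hF]
  · intro g; simp [hG]

/-- Affine coordinates at a point of the plane. -/
theorem exists_coordinates {v : Fin 3 → k} (hv : v ≠ 0) :
    ∃ (a b : Fin 3) (x y z : MvPolynomial (Fin 3) k), x.IsHomogeneous 1 ∧ y.IsHomogeneous 1 ∧
      z.IsHomogeneous 1 ∧ eval v x = 1 ∧ eval v y = 0 ∧ eval v z = 0 ∧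
      pderiv a x = 0 ∧ pderiv b x = 0 ∧ pderiv a y = 1 ∧ pderiv b y = 0 ∧
      pderiv a z = 0 ∧ pderiv b z = 1 := by
  obtain ⟨j, hj⟩ := Function.ne_iff.mp hv
  have hex : ∀ j : Fin 3, ∃ a b : Fin 3, j ≠ a ∧ j ≠ b ∧ a ≠ b := by decide
  obtain ⟨a, b, ha, hb, hab⟩ := hex j
  rw [Pi.zero_apply] at hj
  refine ⟨a, b, C (v j)⁻¹ * X j, X a - C (v a / v j) * X j, X b - C (v b / v j) * X j,
    isHomogeneous_C_mul_X _ _, (isHomogeneous_X _ _).sub (isHomogeneous_C_mul_X _ _),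
    (isHomogeneous_X _ _).sub (isHomogeneous_C_mul_X _ _), ?_, ?_, ?_, ?_, ?_, ?_, ?_, ?_, ?_⟩ <;>
  simp [hj, pderiv_X_of_ne ha, pderiv_X_of_ne hb, pderiv_X_of_ne hab,
    pderiv_X_of_ne hab.symm, -algebraMap_eq, -map_div₀, -map_inv₀]

theorem meetsToOrder_two {v : Fin 3 → k} (hv : v ≠ 0) {F G : MvPolynomial (Fin 3) k}
    (hF : IsSingularAt v F) (hG : eval v G = 0) : MeetsToOrder v F G 2 := by
  obtain ⟨a, b, x, y, z, hx, hy, hz, hxv, hyv, hzv, hax, hbx, hay, hby, haz, hbz⟩ :=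
    exists_coordinates hv
  obtain ⟨s, t, hst, hGst⟩ : ∃ s t : k, (s ≠ 0 ∨ t ≠ 0) ∧
      s * eval v (pderiv a G) + t * eval v (pderiv b G) = 0 := by
    by_cases h : eval v (pderiv a G) = 0
    · exact ⟨1, 0, by simp [h]⟩
    · exact ⟨eval v (pderiv b G), - eval v (pderiv a G), by simp [h], by ring⟩
  obtain ⟨w, hw, hwv, hwst⟩ : ∃ w : MvPolynomial (Fin 3) k, w.IsHomogeneous 1 ∧ eval v w = 0 ∧
      s * eval v (pderiv a w) + t * eval v (pderiv b w) = 1 := by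
    rcases hst with h | h
    · exact ⟨C s⁻¹ * y, hy.C_mul _, by simp [hyv], by simp [hay, hby, h]⟩
    · exact ⟨C t⁻¹ * z, hz.C_mul _, by simp [hzv], by simp [haz, hbz, h]⟩
  refine ⟨⟨⟨fun f => ![eval v f, s * eval v (pderiv a f) + t * eval v (pderiv b f)],
    fun f g => ?_⟩, fun c f => ?_⟩, fun r => ⟨C (r 0) * (x * x) + C (r 1) * (x * w),
      ((hx.mul hx).C_mul _).add ((hx.mul hw).C_mul _), ?_⟩, ?_, ?_, ?_, ?_⟩
  · ext i; fin_cases i <;> simp; ring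
  · ext i; fin_cases i <;> simp [smul_eq_C_mul]; ring
  · ext i
    fin_cases i
    · simp [hxv, hwv]
    · change s * eval v (pderiv a (C (r 0) * (x * x) + C (r 1) * (x * w))) +
        t * eval v (pderiv b (C (r 0) * (x * x) + C (r 1) * (x * w))) = r 1
      simp only [map_add, pderiv_C, pderiv_mul, map_mul, eval_C, hxv, hwv, hax, hbx, map_zero]
      linear_combination r 1 * hwst
  · intro h g hh hg
    have h0 := congrFun hg 0
    have h1 := congrFun hg 1
    simp only [LinearMap.coe_mk, AddHom.coe_mk, pderiv_mul, map_mul, map_add, Matrix.cons_val_zero,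
      Matrix.cons_val_one, Pi.zero_apply, mul_eq_zero, hh, false_or] at h0 h1
    have h2 : eval v h * (s * eval v (pderiv a g) + t * eval v (pderiv b g)) = 0 := by
      rw [h0] at h1
      linear_combination h1
    rw [mul_eq_zero, or_iff_right hh] at h2
    ext i; fin_cases i
    · exact h0
    · exact h2
  · intro l g hl
    ext i; fin_cases i <;> simp [hl]
  · intro g
    ext i; fin_cases i <;> simp [hF.1, hF.2]
  · intro g
    ext i; fin_cases i
    · simp [hG]
    · simp only [LinearMap.coe_mk, AddHom.coe_mk, map_add, pderiv_mul, map_mul, hG]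
      simp only [Fin.mk_one, Matrix.cons_val_one, Matrix.cons_val_fin_one, Pi.zero_apply]
      linear_combination eval v g * hGst

theorem exists_second_order_functional [CharZero k] {v : Fin 3 → k}
    {F G : MvPolynomial (Fin 3) k} (hF : IsSingularAt v F) (hG : IsSingularAt v G) {a b : Fin 3}
    {x y z : MvPolynomial (Fin 3) k} (hy : y.IsHomogeneous 1) (hz : z.IsHomogeneous 1)
    (hyv : eval v y = 0) (hzv : eval v z = 0) (hax : pderiv a x = 0) (hbx : pderiv b x = 0)
    (hay : pderiv a y = 1) (hby : pderiv b y = 0) (haz : pderiv a z = 0) (hbz : pderiv b z = 1) :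
    ∃ Q : MvPolynomial (Fin 3) k →ₗ[k] k, (∀ g, Q (F * g) = 0) ∧ (∀ g, Q (G * g) = 0) ∧
      (∀ l g, eval v l = 0 → Q (l ^ 3 * g) = 0) ∧
      (∀ h g, eval v g = 0 → eval v (pderiv a g) = 0 → eval v (pderiv b g) = 0 →
        Q (h * g) = eval v h * Q g) ∧ Q (x * x) = 0 ∧ Q (x * y) = 0 ∧ Q (x * z) = 0 ∧
      ∃ w : MvPolynomial (Fin 3) k, w.IsHomogeneous 2 ∧ IsSingularAt v w ∧ Q w = 1 := by
  obtain ⟨c, hc, hcF, hcG⟩ : ∃ c : Fin 3 → k, c ≠ 0 ∧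
      (eval v (pderiv a (pderiv a F)) * c 0 + eval v (pderiv a (pderiv b F)) * c 1 +
        eval v (pderiv b (pderiv b F)) * c 2 = 0) ∧
      (eval v (pderiv a (pderiv a G)) * c 0 + eval v (pderiv a (pderiv b G)) * c 1 +
        eval v (pderiv b (pderiv b G)) * c 2 = 0) := by
    let T : MvPolynomial (Fin 3) k → Fin 3 → k := fun f =>
      ![eval v (pderiv a (pderiv a f)), eval v (pderiv a (pderiv b f)),
        eval v (pderiv b (pderiv b f))]
    let M : Matrix (Fin 2) (Fin 3) k := ![T F, T G]
    have := LinearMap.ker_ne_bot_of_finrank_lt (f := M.mulVecLin) (by simp)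
    obtain ⟨c, hc, hc0⟩ := Submodule.exists_mem_ne_zero_of_ne_bot this
    rw [LinearMap.mem_ker, Matrix.mulVecLin_apply] at hc
    refine ⟨c, hc0, ?_, ?_⟩
    · simpa [M, T, Matrix.mulVec, dotProduct, Fin.sum_univ_three] using congrFun hc 0
    · simpa [M, T, Matrix.mulVec, dotProduct, Fin.sum_univ_three] using congrFun hc 1
  obtain ⟨Q, hQ⟩ : ∃ Q : MvPolynomial (Fin 3) k →ₗ[k] k, ∀ f, Q f =
      eval v (pderiv a (pderiv a f)) * c 0 + eval v (pderiv a (pderiv b f)) * c 1 +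
        eval v (pderiv b (pderiv b f)) * c 2 :=
    ⟨⟨⟨fun f => eval v (pderiv a (pderiv a f)) * c 0 + eval v (pderiv a (pderiv b f)) * c 1 +
        eval v (pderiv b (pderiv b f)) * c 2, fun f g => by simp only [map_add]; ring⟩,
        fun r f => by
          simp only [Derivation.map_smul, smul_eval, RingHom.id_apply, smul_eq_mul]; ring⟩,
        fun f => rfl⟩
  have hmul : ∀ h g, eval v g = 0 → eval v (pderiv a g) = 0 → eval v (pderiv b g) = 0 →
      Q (h * g) = eval v h * Q g := fun h g h0 h1 h2 => by
    simp only [hQ, pderiv_mul, map_add, map_mul, h0, h1, h2]; ring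
  refine ⟨Q, fun g => ?_, fun g => ?_, fun l g hl => ?_, hmul, ?_, ?_, ?_, ?_⟩
  · rw [mul_comm, hmul _ _ hF.1 (hF.2 a) (hF.2 b), hQ, hcF, mul_zero]
  · rw [mul_comm, hmul _ _ hG.1 (hG.2 a) (hG.2 b), hQ, hcG, mul_zero]
  · rw [show l ^ 3 * g = g * l * (l * l) by ring, hmul _ _ (by simp [hl]) (by simp [hl])
      (by simp [hl]), map_mul, hl, mul_zero, zero_mul]
  · simp [hQ, hax, hbx]
  · simp [hQ, hax, hbx, hay, hby]
  · simp [hQ, hax, hbx, haz, hbz]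
  · suffices h : ∃ w : MvPolynomial (Fin 3) k, w.IsHomogeneous 2 ∧ IsSingularAt v w ∧ Q w ≠ 0 by
      obtain ⟨w, hw, hwv, hwQ⟩ := h
      exact ⟨(Q w)⁻¹ • w, (homogeneousSubmodule (Fin 3) k 2).smul_mem _ hw,
        ⟨by simp [hwv.1], fun i => by simp [hwv.2]⟩,
        by rw [map_smul, smul_eq_mul, inv_mul_cancel₀ hwQ]⟩
    obtain ⟨i, hi⟩ := Function.ne_iff.mp hc
    fin_cases i
    · refine ⟨y * y, hy.mul hy, ⟨by simp [hyv], fun i => by simp [hyv]⟩, ?_⟩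
      simpa [hQ, hay, hby, one_add_one_eq_two] using hi
    · exact ⟨y * z, hy.mul hz, ⟨by simp [hyv], fun i => by simp [hyv, hzv]⟩,
        by simpa [hQ, hay, hby, haz, hbz] using hi⟩
    · refine ⟨z * z, hz.mul hz, ⟨by simp [hzv], fun i => by simp [hzv]⟩, ?_⟩
      simpa [hQ, haz, hbz, one_add_one_eq_two] using hi

theorem meetsToOrder_four [CharZero k] {v : Fin 3 → k} (hv : v ≠ 0)
    {F G : MvPolynomial (Fin 3) k}
    (hF : IsSingularAt v F) (hG : IsSingularAt v G) : MeetsToOrder v F G 4 := by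
  obtain ⟨a, b, x, y, z, hx, hy, hz, hxv, hyv, hzv, hax, hbx, hay, hby, haz, hbz⟩ :=
    exists_coordinates hv
  obtain ⟨Q, hQF, hQG, hQ3, hQmul, hQxx, hQxy, hQxz, w, hw, hwv, hwQ⟩ :=
    exists_second_order_functional hF hG hy hz hyv hzv hax hbx hay hby haz hbz
  have hC : ∀ r f, Q (C r * f) = r * Q f := fun r f => by
    rw [← smul_eq_C_mul, map_smul, smul_eq_mul]
  let L : MvPolynomial (Fin 3) k →ₗ[k] (Fin 4 → k) :=
    ⟨⟨fun f => ![eval v f, eval v (pderiv a f), eval v (pderiv b f), Q f],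
      fun f g => by ext i; fin_cases i <;> simp⟩,
      fun r f => by ext i; fin_cases i <;> simp [smul_eq_C_mul, hC]⟩
  have hL : ∀ f y, L f = y ↔ eval v f = y 0 ∧ eval v (pderiv a f) = y 1 ∧
      eval v (pderiv b f) = y 2 ∧ Q f = y 3 := fun f y => by
    simp [L, funext_iff, Fin.forall_fin_succ]
  refine ⟨L, fun r => ⟨C (r 0) * (x * x) + C (r 1) * (x * y) +
      C (r 2) * (x * z) + C (r 3) * w, ((((hx.mul hx).C_mul _).add ((hx.mul hy).C_mul _)).add
        ((hx.mul hz).C_mul _)).add (hw.C_mul _), ?_⟩, fun h g hh => ?_, fun l g hl => ?_,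
        fun g => ?_, fun g => ?_⟩ <;> simp only [hL, Pi.zero_apply]
  · refine ⟨?_, ?_, ?_, ?_⟩
    · simp [hxv, hyv, hzv, hwv.1]
    · simp [hxv, hwv.2, hax, hay, haz]
    · simp [hxv, hwv.2, hbx, hby, hbz]
    · simp only [map_add, hC, hQxx, hQxy, hQxz, hwQ]; ring
  · rintro ⟨h0, h1, h2, h3⟩
    replace h0 : eval v g = 0 := by simpa [hh] using h0
    replace h1 : eval v (pderiv a g) = 0 := by simpa [hh, h0] using h1
    replace h2 : eval v (pderiv b g) = 0 := by simpa [hh, h0] using h2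
    rw [hQmul h g h0 h1 h2, mul_eq_zero, or_iff_right hh] at h3
    exact ⟨h0, h1, h2, h3⟩
  · exact ⟨by simp [hl], by simp [hl], by simp [hl], hQ3 l g hl⟩
  · exact ⟨by simp [hF.1], by simp [hF.1, hF.2], by simp [hF.1, hF.2], hQF g⟩
  · exact ⟨by simp [hG.1], by simp [hG.1, hG.2], by simp [hG.1, hG.2], hQG g⟩

end Bezout

section Avoidance

theorem exists_mem_forall_notMem {k E ι : Type*} [Field k] [Infinite k] [AddCommGroup E]
    [Module k E] [Finite ι] (W : Submodule k E) (Q : ι → Submodule k E)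
    (h : ∀ i, ∃ w ∈ W, w ∉ Q i) : ∃ w ∈ W, ∀ i, w ∉ Q i := by
  by_contra! hcon
  obtain ⟨i, hi⟩ := Subspace.exists_eq_top_of_iUnion_eq_univ
    (p := fun i => (Q i).comap W.subtype) (by
      ext w
      simpa using hcon w w.2)
  obtain ⟨w, hw, hwi⟩ := h i
  exact hwi (by simpa using hi.ge (Submodule.mem_top (x := ⟨w, hw⟩)))

variable {k A : Type*} [Field k] [Infinite k] [CommRing A] [IsDomain A] [Algebra k A]
  [UniqueFactorizationMonoid A]

theorem exists_isRelPrime_or_exists_prime_dvd {F : A} (hF : F ≠ 0) (W : Submodule k A) :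
    (∃ G ∈ W, IsRelPrime F G) ∨ ∃ p, Prime p ∧ p ∣ F ∧ ∀ g ∈ W, p ∣ g := by
  by_contra! hcon
  obtain ⟨hrel, hdvd⟩ := hcon
  classical
  obtain ⟨G, hG, hGF⟩ := exists_mem_forall_notMem W
    (fun p : (UniqueFactorizationMonoid.factors F).toFinset =>
      (Ideal.span {(p : A)}).restrictScalars k) (by
      rintro ⟨p, hp⟩
      rw [Multiset.mem_toFinset] at hp
      simpa [Ideal.mem_span_singleton] using
        hdvd p (UniqueFactorizationMonoid.prime_of_factor p hp)
          (UniqueFactorizationMonoid.dvd_of_mem_factors hp))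
  refine hrel G hG ((UniqueFactorizationMonoid.isRelPrime_iff_no_prime_factors hF).mpr ?_)
  intro p hpF hpG hp
  obtain ⟨q, hq, hpq⟩ := UniqueFactorizationMonoid.exists_mem_factors_of_dvd hF hp.irreducible hpF
  refine hGF ⟨q, Multiset.mem_toFinset.mpr hq⟩ ?_
  simpa [Ideal.mem_span_singleton] using hpq.symm.dvd.trans hpG

/-- Splitting off a common divisor `D` of `F` and `W`, the cofactor of `F` is coprime to that of
some element of `W`. -/
theorem exists_eq_mul_isRelPrime {F : A} (hF : F ≠ 0) (W : Submodule k A) :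
    ∃ D F' G', F = D * F' ∧ (∀ f ∈ W, D ∣ f) ∧ D * G' ∈ W ∧ IsRelPrime F' G' := by
  induction F using (wellFounded_dvdNotUnit (α := A)).induction generalizing W with
  | _ F ih =>
  obtain ⟨G, hG, hFG⟩ | ⟨p, hp, ⟨F₁, rfl⟩, hpW⟩ := exists_isRelPrime_or_exists_prime_dvd hF W
  · exact ⟨1, F, G, (one_mul _).symm, fun f _ => one_dvd f, by simpa using hG, hFG⟩
  · have hF₁ := right_ne_zero_of_mul hF
    obtain ⟨D, F', G', rfl, hD, hG', hrel⟩ := ih F₁ ⟨hF₁, p, hp.not_isUnit, mul_comm _ _⟩ hF₁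
      (W.comap (LinearMap.mulLeft k p))
    refine ⟨p * D, F', G', (mul_assoc _ _ _).symm, fun f hf => ?_, by simpa [mul_assoc] using hG',
      hrel⟩
    obtain ⟨g, rfl⟩ := hpW f hf
    exact mul_dvd_mul_left p (hD g hf)

end Avoidance

section SingularPoints

variable {k : Type} [Field k] {v : Fin 3 → k} {f g : MvPolynomial (Fin 3) k}

theorem IsSingularAt.mul_left (h : IsSingularAt v g) (f : MvPolynomial (Fin 3) k) :
    IsSingularAt v (f * g) :=
  ⟨by simp [h.1], fun i => by simp [h.1, h.2]⟩

theorem isSingularAt_mul_iff (hf : eval v f ≠ 0) :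
    IsSingularAt v (f * g) ↔ IsSingularAt v g := by
  refine ⟨fun h => ?_, fun h => h.mul_left f⟩
  have h0 : eval v g = 0 := by simpa [hf] using h.1
  exact ⟨h0, fun i => by simpa [hf, h0] using h.2 i⟩

theorem eval_eq_zero_of_isSingularAt_mul (h : IsSingularAt v (f * g)) (hf : ¬ IsSingularAt v f) :
    eval v g = 0 := by
  by_contra hg
  rw [mul_comm, isSingularAt_mul_iff hg] at h
  exact hf h

theorem not_isUnit_of_isHomogeneous {n : ℕ} (hf : f.IsHomogeneous n) (hn : n ≠ 0) :
    ¬ IsUnit f := by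
  intro h
  obtain ⟨c, hc, rfl⟩ := isUnit_iff_eq_C_of_isReduced.mp h
  exact hn (hf.inj_right (isHomogeneous_C _ c) (by simpa using hc.ne_zero))

theorem isUnit_of_totalDegree_eq_zero (h0 : f ≠ 0) (h : f.totalDegree = 0) : IsUnit f := by
  rw [totalDegree_eq_zero_iff_eq_C] at h
  rw [h] at h0 ⊢
  exact (IsUnit.mk0 _ (by simpa using h0)).map C

theorem eval_ne_zero_of_isHomogeneous_zero (hf : f.IsHomogeneous 0) (h0 : f ≠ 0) :
    eval v f ≠ 0 := by
  obtain ⟨c, rfl⟩ : ∃ c, f = C c :=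
    ⟨_, totalDegree_eq_zero_iff_eq_C.mp (hf.totalDegree h0)⟩
  simpa using h0

theorem sum_mul_eval_pderiv {n : ℕ} (hf : f.IsHomogeneous n) :
    ∑ i, v i * eval v (pderiv i f) = n * eval v f := by
  simpa using congrArg (eval v) hf.sum_X_mul_pderiv

theorem eq_sum_of_isHomogeneous_one (hf : f.IsHomogeneous 1) :
    f = ∑ i, C (eval v (pderiv i f)) * X i := by
  have h := hf.sum_X_mul_pderiv
  rw [one_smul] at h
  conv_lhs => rw [← h]
  refine Finset.sum_congr rfl fun i _ => ?_
  have h0 := totalDegree_eq_zero_iff_eq_C.mp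
    (Nat.le_zero.mp (hf.pderiv (i := i)).totalDegree_le)
  conv_lhs => rw [h0]
  conv_rhs => rw [h0]
  simp [mul_comm]

theorem eq_zero_of_isHomogeneous_one (hf : f.IsHomogeneous 1) (h : IsSingularAt v f) : f = 0 := by
  rw [eq_sum_of_isHomogeneous_one (v := v) hf]
  simp [h.2]

/-- Evaluation at `v`, as a linear functional. -/
noncomputable def evalAt (v : Fin 3 → k) : MvPolynomial (Fin 3) k →ₗ[k] k :=
  (aeval v).toLinearMap

@[simp]
theorem evalAt_apply (v : Fin 3 → k) (f : MvPolynomial (Fin 3) k) : evalAt v f = eval v f := by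
  simp [evalAt]

/-- The gradient at `v`. -/
noncomputable def gradientAt (v : Fin 3 → k) : MvPolynomial (Fin 3) k →ₗ[k] (Fin 3 → k) :=
  LinearMap.pi fun i => evalAt v ∘ₗ (pderiv i).toLinearMap

@[simp]
theorem gradientAt_apply (v : Fin 3 → k) (f : MvPolynomial (Fin 3) k) (i : Fin 3) :
    gradientAt v f i = eval v (pderiv i f) := by
  simp [gradientAt]

theorem exists_gradientAt_mul_eq [CharZero k] {n : ℕ} (hf : f.IsHomogeneous n)
    (hfv : eval v f ≠ 0) (y : Fin 3 → k) :
    ∃ l : MvPolynomial (Fin 3) k, l.IsHomogeneous 1 ∧ gradientAt v (f * l) = y := by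
  have hn : (n + 1 : k) ≠ 0 := by exact_mod_cast n.succ_ne_zero
  have hE := sum_mul_eval_pderiv (v := v) hf
  set s := (∑ i, v i * y i) / ((n + 1) * eval v f) with hs
  let c : Fin 3 → k := fun i => (y i - s * eval v (pderiv i f)) / eval v f
  have hl : (∑ i, C (c i) * X i : MvPolynomial (Fin 3) k).IsHomogeneous 1 :=
    IsHomogeneous.sum _ _ _ fun i _ => isHomogeneous_C_mul_X _ _
  refine ⟨∑ i, C (c i) * X i, hl, ?_⟩
  have hev : eval v (∑ i, C (c i) * X i) = s := by
    have h1 : eval v f * ∑ i, c i * v i = ∑ i, v i * y i - s * (n * eval v f) := by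
      rw [← hE, Finset.mul_sum, Finset.mul_sum, ← Finset.sum_sub_distrib]
      refine Finset.sum_congr rfl fun i _ => ?_
      simp only [c]
      field_simp
    have h2 : ∑ i, v i * y i = s * ((n + 1) * eval v f) := by
      rw [hs]; field_simp
    rw [h2] at h1
    simp only [map_sum, map_mul, eval_C, eval_X]
    apply mul_left_cancel₀ hfv
    rw [h1]; ring
  ext i
  rw [gradientAt_apply, pderiv_mul, map_add, map_mul, map_mul, hev]
  have : eval v (pderiv i (∑ j, C (c j) * X j)) = c i := by
    simp [Pi.single_apply]
  rw [this]
  simp only [c]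
  field_simp
  ring

end SingularPoints

section Divisors

variable {k : Type} [Field k] {D : MvPolynomial (Fin 3) k}

theorem exists_mul_self_dvd [CharZero k] {p : MvPolynomial (Fin 3) k} {n : ℕ} (hp : Prime p)
    (hD : D.IsHomogeneous n) (hD0 : D ≠ 0) (hpD : p ∣ D) (h : ∀ i, p ∣ pderiv i D) :
    p * p ∣ D := by
  obtain ⟨G, rfl⟩ := hpD
  refine mul_dvd_mul_left p ?_
  by_contra hpG
  have hhom := (isHomogeneous_of_mul hD hD0).1
  have hder : ∀ i, pderiv i p = 0 := by
    intro i
    have h1 : p ∣ pderiv i p * G := by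
      have := h i
      rw [pderiv_mul] at this
      exact (dvd_add_left (dvd_mul_right p _)).mp this
    obtain ⟨r, hr⟩ := (hp.dvd_or_dvd h1).resolve_right hpG
    by_contra h0
    have h2 := (hhom.pderiv (i := i)).totalDegree h0
    rw [hr] at h0 h2
    rw [totalDegree_mul_of_isDomain (left_ne_zero_of_mul h0) (right_ne_zero_of_mul h0)] at h2
    have h3 : p.totalDegree = 0 := by omega
    exact hp.not_isUnit (isUnit_of_totalDegree_eq_zero hp.ne_zero h3)
  have hE := hhom.sum_X_mul_pderiv
  simp only [hder, mul_zero, Finset.sum_const_zero] at hE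
  have h3 : p.totalDegree = 0 := by simpa [hp.ne_zero] using hE.symm
  exact hp.not_isUnit (isUnit_of_totalDegree_eq_zero hp.ne_zero h3)

/-- A reduced plane curve of degree `d` has at most `d (d - 1) / 2` singular points. -/
theorem two_mul_card_le_or_exists_mul_self_dvd [CharZero k] {ι : Type} [Fintype ι] [DecidableEq ι]
    {v : ι → Fin 3 → k} (hv : AreSeparated v) {d : ℕ} (hd : d ≠ 0) (hD : D.IsHomogeneous d)
    (hD0 : D ≠ 0) (S : Finset ι) (hS : ∀ i ∈ S, IsSingularAt (v i) D) :
    2 * S.card ≤ d * (d - 1) ∨ ∃ E, ¬ IsUnit E ∧ E * E ∣ D := by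
  obtain ⟨G, hG, hrel⟩ | ⟨p, hp, hpD, h⟩ := exists_isRelPrime_or_exists_prime_dvd hD0
    (Submodule.span k (Set.range fun i => pderiv i D))
  · left
    have hGhom : G.IsHomogeneous (d - 1) := by
      refine (Submodule.span_le (p := homogeneousSubmodule (Fin 3) k (d - 1))).mpr ?_ hG
      rintro _ ⟨i, rfl⟩
      exact hD.pderiv
    have hGS : ∀ i ∈ S, eval (v i) G = 0 := by
      intro i hi
      have : Submodule.span k (Set.range fun i => pderiv i D) ≤
          LinearMap.ker (evalAt (v i)) := by
        rw [Submodule.span_le]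
        rintro _ ⟨j, rfl⟩
        simpa using (hS i hi).2 j
      simpa using this hG
    have hG0 : G ≠ 0 := by
      rintro rfl
      exact not_isUnit_of_isHomogeneous hD hd (isRelPrime_zero_right.mp hrel)
    have := sum_le_mul_of_meetsToOrder hv hD hGhom hD0 hG0 hrel (fun i => if i ∈ S then 2 else 0)
      (fun i => by
        split_ifs with hi
        · exact meetsToOrder_two (hv.1 i) (hS i hi) (hGS i hi)
        · exact meetsToOrder_zero _ _ _)
    rw [Finset.sum_ite_mem, Finset.univ_inter, Finset.sum_const, smul_eq_mul] at this
    omega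
  · exact Or.inr ⟨p, hp.not_isUnit, exists_mul_self_dvd hp hD hD0 hpD
      fun i => h _ (Submodule.subset_span ⟨i, rfl⟩)⟩

end Divisors

section Conditions

variable {k : Type} [Field k]

theorem finrank_domRestrict_pi {E ι : Type*} [AddCommGroup E] [Module k E] (L : ι → E →ₗ[k] k)
    (V : Submodule k E) [FiniteDimensional k V] :
    Module.finrank k (LinearMap.range ((LinearMap.pi L).domRestrict V)) +
      Module.finrank k ↥(V ⊓ ⨅ i, LinearMap.ker (L i)) = Module.finrank k V := by
  have hker : (LinearMap.ker ((LinearMap.pi L).domRestrict V)).map V.subtype =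
      V ⊓ ⨅ i, LinearMap.ker (L i) := by
    rw [← Submodule.map_comap_subtype, ← LinearMap.ker_pi]
    rfl
  rw [← hker, Submodule.finrank_map_subtype_eq]
  exact LinearMap.finrank_range_add_finrank_ker _

theorem finrank_le_card_add_finrank {E ι : Type*} [AddCommGroup E] [Module k E] [Fintype ι]
    (L : ι → E →ₗ[k] k) (V : Submodule k E) [FiniteDimensional k V] :
    Module.finrank k V ≤ Fintype.card ι + Module.finrank k ↥(V ⊓ ⨅ i, LinearMap.ker (L i)) := by
  rw [← finrank_domRestrict_pi L V]
  gcongr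
  exact (Submodule.finrank_le _).trans (Module.finrank_fintype_fun_eq_card k).le

theorem exists_separator {E ι : Type*} [AddCommGroup E] [Module k E] [Fintype ι] [DecidableEq ι]
    (L : ι → E →ₗ[k] k) (V : Submodule k E) [FiniteDimensional k V]
    (h : Module.finrank k ↥(V ⊓ ⨅ i, LinearMap.ker (L i)) + Fintype.card ι ≤ Module.finrank k V)
    (i : ι) : ∃ f ∈ V, L i f = 1 ∧ ∀ j, j ≠ i → L j f = 0 := by
  have hrange : LinearMap.range ((LinearMap.pi L).domRestrict V) = ⊤ := by
    refine Submodule.eq_top_of_finrank_eq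
      (le_antisymm (Submodule.finrank_le _) ?_)
    rw [Module.finrank_fintype_fun_eq_card]
    have := finrank_domRestrict_pi L V
    omega
  obtain ⟨f, hf⟩ := LinearMap.range_eq_top.mp hrange (Pi.single i 1)
  refine ⟨f, f.2, ?_, fun j hj => ?_⟩
  · simpa using congrFun hf i
  · simpa [hj] using congrFun hf j

/-- The forms `g` of degree `t` such that `D * g` is singular at all the points `v i`. -/
def singularMultiples {ι : Type} (v : ι → Fin 3 → k) (D : MvPolynomial (Fin 3) k) (t : ℕ) :
    Submodule k (MvPolynomial (Fin 3) k) where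
  carrier := {g | g.IsHomogeneous t ∧ ∀ i, IsSingularAt (v i) (D * g)}
  zero_mem' := ⟨isHomogeneous_zero _ _ _, fun i => by simp [IsSingularAt]⟩
  add_mem' := fun hf hg => ⟨hf.1.add hg.1, fun i =>
    ⟨by rw [mul_add, map_add, (hf.2 i).1, (hg.2 i).1, add_zero], fun j => by
      rw [mul_add, map_add, map_add, (hf.2 i).2, (hg.2 i).2, add_zero]⟩⟩
  smul_mem' := fun c f hf => ⟨(homogeneousSubmodule (Fin 3) k t).smul_mem c hf.1, fun i => by
    rw [smul_eq_C_mul, mul_left_comm]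
    exact (hf.2 i).mul_left _⟩

theorem singularMultiples_le {ι : Type} (v : ι → Fin 3 → k) (D : MvPolynomial (Fin 3) k) (t : ℕ) :
    singularMultiples v D t ≤ homogeneousSubmodule (Fin 3) k t :=
  fun _ hf => hf.1

instance {ι : Type} (v : ι → Fin 3 → k) (D : MvPolynomial (Fin 3) k) (t : ℕ) :
    FiniteDimensional k (singularMultiples v D t) :=
  Submodule.finiteDimensional_of_le (singularMultiples_le v D t)

theorem finrank_singularMultiples_add_le [CharZero k] {ι : Type} [DecidableEq ι]
    {v : ι → Fin 3 → k} {D : MvPolynomial (Fin 3) k} {d m n : ℕ} (hD : D.IsHomogeneous d)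
    (hn : d + m * 2 + 1 = n) (A B : Finset ι) (hA : ∀ i ∈ A, eval (v i) D ≠ 0)
    (hB : ∀ i ∈ B, eval (v i) D = 0) (hB' : ∀ i ∈ B, ¬ IsSingularAt (v i) D)
    (hsepA : ∀ i ∈ A, ∃ q : MvPolynomial (Fin 3) k, q.IsHomogeneous m ∧ eval (v i) q ≠ 0 ∧
      ∀ j ∈ A, j ≠ i → eval (v j) q = 0)
    (hsepB : ∀ i ∈ B, ∃ f : MvPolynomial (Fin 3) k, f.IsHomogeneous n ∧ eval (v i) f ≠ 0 ∧
      ∀ j ∈ B, j ≠ i → eval (v j) f = 0) :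
    Module.finrank k (singularMultiples v D n) + 3 * A.card + B.card ≤ (n + 2).choose 2 := by
  set U := homogeneousSubmodule (Fin 3) k n ⊓ ⨅ i : B, LinearMap.ker (evalAt (v i)) with hU
  have : FiniteDimensional k U := Submodule.finiteDimensional_of_le inf_le_left
  have h1 : Module.finrank k U + ∑ i : B, Module.finrank k k = (n + 2).choose 2 := by
    rw [← finrank_homogeneousSubmodule_fin_three (k := k)]
    refine finrank_inf_iInf_ker_add_sum _ (fun i : B => evalAt (v i)) ?_
    rintro ⟨i, hi⟩ y
    obtain ⟨f, hf, hfi, hfj⟩ := hsepB i hi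
    refine ⟨C (y / eval (v i) f) * f, hf.C_mul _, by simp [hfi], ?_⟩
    rintro ⟨j, hj⟩ hji
    simp [hfj j hj (by simpa using hji)]
  have h2 : Module.finrank k ↥(U ⊓ ⨅ i : A, LinearMap.ker (gradientAt (v i))) +
      ∑ i : A, Module.finrank k (Fin 3 → k) = Module.finrank k U := by
    refine finrank_inf_iInf_ker_add_sum _ (fun i : A => gradientAt (v i)) ?_
    rintro ⟨i, hi⟩ y
    obtain ⟨q, hq, hqi, hqj⟩ := hsepA i hi
    obtain ⟨l, hl, hly⟩ := exists_gradientAt_mul_eq (hD.mul (hq.pow 2))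
      (v := v i) (by simp [hqi, hA i hi]) y
    refine ⟨_, ⟨hn ▸ (hD.mul (hq.pow 2)).mul hl, ?_⟩, hly, ?_⟩
    · rw [SetLike.mem_coe, Submodule.mem_iInf]
      intro j
      simp [hB j j.2]
    · rintro ⟨j, hj⟩ hji
      ext a
      simp [pow_two, hqj j hj (by simpa using hji)]
  have h3 : singularMultiples v D n ≤ U ⊓ ⨅ i : A, LinearMap.ker (gradientAt (v i)) := by
    rintro g ⟨hg, hgD⟩
    refine ⟨⟨hg, ?_⟩, ?_⟩
    · rw [SetLike.mem_coe, Submodule.mem_iInf]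
      intro i
      simpa using eval_eq_zero_of_isSingularAt_mul (hgD i) (hB' i i.2)
    · rw [SetLike.mem_coe, Submodule.mem_iInf]
      intro i
      ext a
      simpa using ((isSingularAt_mul_iff (hA i i.2)).mp (hgD i)).2 a
  have h4 := Submodule.finrank_mono h3
  simp only [Module.finrank_self, Module.finrank_fin_fun, Finset.sum_const, Finset.card_univ,
    Fintype.card_coe, smul_eq_mul] at h1 h2
  omega

end Conditions

section Curves

variable {k : Type} [Field k] {ι : Type} {v : ι → Fin 3 → k}

theorem eq_zero_of_eval_eq_zero
    (h3 : ∀ f : MvPolynomial (Fin 3) k, f.IsHomogeneous 3 → (∀ i, eval (v i) f = 0) → f = 0)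
    {Q : MvPolynomial (Fin 3) k} {e m : ℕ} (hQ : Q.IsHomogeneous e) (hQ0 : Q ≠ 0) (hem : e + m = 3)
    {A : Finset ι} (hA : ∀ i, i ∉ A → eval (v i) Q = 0) :
    homogeneousSubmodule (Fin 3) k m ⊓ ⨅ i : A, LinearMap.ker (evalAt (v i)) = ⊥ := by
  rw [eq_bot_iff]
  rintro f ⟨hf, hfA⟩
  rw [SetLike.mem_coe, Submodule.mem_iInf] at hfA
  refine (mul_eq_zero.mp (h3 (Q * f) (by simpa [hem] using hQ.mul hf) fun i => ?_)).resolve_left hQ0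
  by_cases hi : i ∈ A
  · have : eval (v i) f = 0 := by simpa using hfA ⟨i, hi⟩
    simp [this]
  · simp [hA i hi]

theorem choose_le_card
    (h3 : ∀ f : MvPolynomial (Fin 3) k, f.IsHomogeneous 3 → (∀ i, eval (v i) f = 0) → f = 0)
    {Q : MvPolynomial (Fin 3) k} {e m : ℕ} (hQ : Q.IsHomogeneous e) (hQ0 : Q ≠ 0) (hem : e + m = 3)
    {A : Finset ι} (hA : ∀ i, i ∉ A → eval (v i) Q = 0) : (m + 2).choose 2 ≤ A.card := by
  have := finrank_le_card_add_finrank (fun i : A => evalAt (v i)) (homogeneousSubmodule (Fin 3) k m)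
  rw [eq_zero_of_eval_eq_zero h3 hQ hQ0 hem hA, finrank_bot, add_zero, Fintype.card_coe,
    finrank_homogeneousSubmodule_fin_three] at this
  exact this

theorem exists_separator_of_card_le
    (h3 : ∀ f : MvPolynomial (Fin 3) k, f.IsHomogeneous 3 → (∀ i, eval (v i) f = 0) → f = 0)
    {Q : MvPolynomial (Fin 3) k} {e m : ℕ} (hQ : Q.IsHomogeneous e) (hQ0 : Q ≠ 0) (hem : e + m = 3)
    {A : Finset ι} (hA : ∀ i, i ∉ A → eval (v i) Q = 0) (hcard : A.card ≤ (m + 2).choose 2) :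
    ∀ i ∈ A, ∃ q : MvPolynomial (Fin 3) k, q.IsHomogeneous m ∧ eval (v i) q ≠ 0 ∧
      ∀ j ∈ A, j ≠ i → eval (v j) q = 0 := by
  classical
  intro i hi
  obtain ⟨q, hq, hqi, hqj⟩ := exists_separator (fun i : A => evalAt (v i))
    (homogeneousSubmodule (Fin 3) k m) (by
      rw [eq_zero_of_eval_eq_zero h3 hQ hQ0 hem hA, finrank_bot, zero_add, Fintype.card_coe,
        finrank_homogeneousSubmodule_fin_three]
      exact hcard) ⟨i, hi⟩
  refine ⟨q, hq, ?_, fun j hj hji => ?_⟩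
  · rw [evalAt_apply] at hqi
    rw [hqi]; exact one_ne_zero
  · simpa using hqj ⟨j, hj⟩ (by simpa using hji)

end Curves

section DoublePoints

variable {k : Type} [Field k] {ι : Type} {v : ι → Fin 3 → k}

theorem four_mul_card_add_card_le [CharZero k] [Fintype ι] [DecidableEq ι] (hv : AreSeparated v)
    {D F G : MvPolynomial (Fin 3) k} {p q : ℕ} (hF : F.IsHomogeneous p) (hG : G.IsHomogeneous q)
    (hF0 : F ≠ 0) (hG0 : G ≠ 0) (hFG : IsRelPrime F G) (hDF : ∀ i, IsSingularAt (v i) (D * F))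
    (hDG : ∀ i, IsSingularAt (v i) (D * G)) {A B : Finset ι} (hAB : Disjoint A B)
    (hA : ∀ i ∈ A, eval (v i) D ≠ 0) (hB : ∀ i ∈ B, ¬ IsSingularAt (v i) D) :
    4 * A.card + B.card ≤ p * q := by
  have h := sum_le_mul_of_meetsToOrder hv hF hG hF0 hG0 hFG
    (fun i => (if i ∈ A then 4 else 0) + if i ∈ B then 1 else 0) (fun i => by
      by_cases hiA : i ∈ A
      · rw [if_pos hiA, if_neg (Finset.disjoint_left.mp hAB hiA)]
        exact meetsToOrder_four (hv.1 i) ((isSingularAt_mul_iff (hA i hiA)).mp (hDF i))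
          ((isSingularAt_mul_iff (hA i hiA)).mp (hDG i))
      · rw [if_neg hiA]
        split_ifs with hiB
        · exact meetsToOrder_one (hv.1 i) (eval_eq_zero_of_isSingularAt_mul (hDF i) (hB i hiB))
            (eval_eq_zero_of_isSingularAt_mul (hDG i) (hB i hiB))
        · exact meetsToOrder_zero _ _ _)
  simp only [Finset.sum_add_distrib, Finset.sum_ite_mem, Finset.univ_inter, Finset.sum_const,
    smul_eq_mul] at h
  omega

theorem finrank_singularMultiples_succ_add_le [Infinite k] [Finite ι] [Nonempty ι]
    (hv : ∀ i, v i ≠ 0)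
    (D : MvPolynomial (Fin 3) k) (t : ℕ) :
    Module.finrank k (singularMultiples v D (t + 1)) + (t + 2).choose 2 ≤
      (t + 3).choose 2 + Module.finrank k (singularMultiples v D t) := by
  obtain ⟨l, hl, hlv⟩ := exists_mem_forall_notMem (homogeneousSubmodule (Fin 3) k 1)
    (fun i => LinearMap.ker (evalAt (v i))) (fun i => by
      obtain ⟨l, hl, hlv⟩ := exists_linear_eval_ne_zero (hv i)
      exact ⟨l, hl, by simpa using hlv⟩)
  rw [mem_homogeneousSubmodule] at hl
  replace hlv : ∀ i, eval (v i) l ≠ 0 := by simpa using hlv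
  have hl0 : l ≠ 0 := by
    rintro rfl
    exact hlv (Classical.arbitrary ι) (map_zero _)
  have hsup : singularMultiples v D (t + 1) ⊔
      (homogeneousSubmodule (Fin 3) k t).map (LinearMap.mulLeft k l) ≤
      homogeneousSubmodule (Fin 3) k (t + 1) := by
    refine sup_le (singularMultiples_le _ _ _) ?_
    rintro _ ⟨f, hf, rfl⟩
    simpa [add_comm] using hl.mul hf
  have hinf : singularMultiples v D (t + 1) ⊓
      (homogeneousSubmodule (Fin 3) k t).map (LinearMap.mulLeft k l) ≤
      (singularMultiples v D t).map (LinearMap.mulLeft k l) := by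
    rintro _ ⟨hf, ⟨f, hf', rfl⟩⟩
    refine ⟨f, ⟨hf', fun i => ?_⟩, rfl⟩
    have := hf.2 i
    rwa [LinearMap.mulLeft_apply, mul_left_comm, isSingularAt_mul_iff (hlv i)] at this
  have h1 := Submodule.finrank_sup_add_finrank_inf_eq (singularMultiples v D (t + 1))
    ((homogeneousSubmodule (Fin 3) k t).map (LinearMap.mulLeft k l))
  have h2 := Submodule.finrank_mono hsup
  have h3 := Submodule.finrank_mono hinf
  rw [finrank_map_mulLeft hl0, finrank_homogeneousSubmodule_fin_three] at h1
  rw [finrank_homogeneousSubmodule_fin_three] at h2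
  change _ ≤ (t + 3).choose 2 at h2
  rw [finrank_map_mulLeft hl0] at h3
  omega

theorem not_mul_self_dvd 
    (h3 : ∀ f : MvPolynomial (Fin 3) k, f.IsHomogeneous 3 → (∀ i, eval (v i) f = 0) → f = 0)
    {D : MvPolynomial (Fin 3) k} {d : ℕ} (hD : D.IsHomogeneous d) (hD0 : D ≠ 0) (hd : d ≤ 3)
    {A B : Finset ι} (hA : ∀ i, i ∉ A → eval (v i) D = 0)
    (hB : ∀ i, i ∉ A → i ∉ B → IsSingularAt (v i) D)
    (hcard : 4 * A.card + B.card ≤ (6 - d) * (7 - d)) :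
    ∀ E, ¬ IsUnit E → ¬ E * E ∣ D := by
  rintro E hE ⟨Q, rfl⟩
  have hE0 : E ≠ 0 := by rintro rfl; simp at hD0
  have hQ0 : Q ≠ 0 := right_ne_zero_of_mul hD0
  have hEhom := (isHomogeneous_of_mul (mul_assoc E E Q ▸ hD) (mul_assoc E E Q ▸ hD0)).1
  have hdeg := hD.totalDegree hD0
  rw [totalDegree_mul_of_isDomain (mul_ne_zero hE0 hE0) hQ0,
    totalDegree_mul_of_isDomain hE0 hE0] at hdeg
  have hEpos : E.totalDegree ≠ 0 := fun h => hE (isUnit_of_totalDegree_eq_zero hE0 h)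
  have hE1 : E.totalDegree = 1 := by omega
  rw [hE1] at hEhom hdeg
  have hQhom : Q.IsHomogeneous (d - 2) :=
    isHomogeneous_of_mul_left (m := 2) (by rwa [show 2 + (d - 2) = d by omega])
      (hEhom.mul hEhom) (mul_ne_zero hE0 hE0)
  have hEA : ∀ i, i ∉ A → eval (v i) E = 0 := by
    intro i hi
    obtain rfl | rfl : d = 2 ∨ d = 3 := by omega
    · have hQv := eval_ne_zero_of_isHomogeneous_zero (v := v i) hQhom hQ0
      simpa [hQv] using hA i hi
    · have hA3 := choose_le_card h3 (hEhom.mul hQhom) (mul_ne_zero hE0 hQ0) (m := 1) rfl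
        (A := A) (fun i hi => by simpa using hA i hi)
      have hB0 : B.card = 0 := by
        norm_num [Nat.choose_two_right] at hA3 hcard
        omega
      by_contra hEi
      have hsing := hB i hi (by simp [Finset.card_eq_zero.mp hB0])
      rw [isSingularAt_mul_iff (by simpa using hEi)] at hsing
      exact hQ0 (eq_zero_of_isHomogeneous_one hQhom hsing)
  have hA6 := choose_le_card h3 hEhom hE0 (m := 2) rfl hEA
  obtain rfl | rfl : d = 2 ∨ d = 3 := by omega
  all_goals
    norm_num [Nat.choose_two_right] at hA6 hcard
    omega

/-- If exactly one sextic is singular at the eleven points, at most five independent septics are. -/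
theorem finrank_singularMultiples_le_five [CharZero k] {v : Fin 11 → Fin 3 → k}
    (hv : AreSeparated v)
    (h3 : ∀ f : MvPolynomial (Fin 3) k, f.IsHomogeneous 3 → (∀ i, eval (v i) f = 0) → f = 0)
    (h4 : ∀ i, ∃ f : MvPolynomial (Fin 3) k, f.IsHomogeneous 4 ∧ eval (v i) f ≠ 0 ∧
      ∀ j, j ≠ i → eval (v j) f = 0)
    (h6 : Module.finrank k (singularMultiples v 1 6) = 1) :
    Module.finrank k (singularMultiples v 1 7) ≤ 5 := by
  by_contra! h7
  obtain ⟨F, hF, hF0⟩ := Submodule.exists_mem_ne_zero_of_ne_bot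
    (p := singularMultiples v 1 6) (by rintro h; rw [h, finrank_bot] at h6; omega)
  obtain ⟨D, F', G', rfl, hD7, hG', hrel⟩ := exists_eq_mul_isRelPrime hF0 (singularMultiples v 1 7)
  obtain ⟨hF, hFs⟩ := hF
  obtain ⟨hG, hGs⟩ := hG'
  simp only [one_mul] at hFs hGs
  have hD0 : D ≠ 0 := left_ne_zero_of_mul hF0
  have hF'0 : F' ≠ 0 := right_ne_zero_of_mul hF0
  obtain ⟨hD, hdeg⟩ := isHomogeneous_of_mul hF hF0
  set d := D.totalDegree with hd
  have hF' : F'.IsHomogeneous (6 - d) :=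
    isHomogeneous_of_mul_left (m := d) (by rwa [show d + (6 - d) = 6 by omega]) hD hD0
  have hG' : G'.IsHomogeneous (7 - d) :=
    isHomogeneous_of_mul_left (m := d) (by rwa [show d + (7 - d) = 7 by omega]) hD hD0
  have hW : 6 ≤ Module.finrank k (singularMultiples v D (7 - d)) := by
    refine h7.trans_le (finrank_le_of_forall_mul (D := D) fun f hf => ?_)
    obtain ⟨g, rfl⟩ := hD7 f hf
    refine ⟨g, ⟨isHomogeneous_of_mul_left (m := d) (n := 7 - d) ?_ hD hD0, ?_⟩, rfl⟩
    · rw [show d + (7 - d) = 7 by omega]; exact hf.1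
    · simpa using hf.2
  obtain hd4 | hd3 := le_or_gt 4 d
  · have hW6 : Module.finrank k (singularMultiples v D (6 - d)) ≤ 1 := by
      rw [← h6, ← finrank_map_mulLeft hD0]
      refine Submodule.finrank_mono ?_
      rintro _ ⟨g, hg, rfl⟩
      refine ⟨?_, by simpa using hg.2⟩
      have := hD.mul hg.1
      rwa [show d + (6 - d) = 6 by omega] at this
    have hlin := finrank_singularMultiples_succ_add_le hv.1 D (6 - d)
    rw [show 6 - d + 1 = 7 - d by omega] at hlin
    obtain h | h | h : d = 4 ∨ d = 5 ∨ d = 6 := by omega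
    all_goals
      rw [h] at hlin hW hW6
      norm_num [Nat.choose_two_right] at hlin hW hW6
      omega
  have hG'0 : G' ≠ 0 := by
    rintro rfl
    exact not_isUnit_of_isHomogeneous hF' (by omega) (isRelPrime_zero_right.mp hrel)
  classical
  let A := Finset.univ.filter fun i => eval (v i) D ≠ 0
  let S := Finset.univ.filter fun i => IsSingularAt (v i) D
  let B := Finset.univ.filter fun i => eval (v i) D = 0 ∧ ¬ IsSingularAt (v i) D
  have hAB : Disjoint A B := Finset.disjoint_left.mpr fun i hi hi' => by
    simp only [A, B, Finset.mem_filter] at hi hi'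
    exact hi.2 hi'.2.1
  have hABS : 11 ≤ A.card + B.card + S.card := by
    calc 11 = (Finset.univ : Finset (Fin 11)).card := by simp
      _ ≤ (A ∪ B ∪ S).card := Finset.card_le_card fun i _ => by
        simp only [A, B, S, Finset.mem_union, Finset.mem_filter, Finset.mem_univ, true_and]
        tauto
      _ ≤ _ := (Finset.card_union_le _ _).trans (by gcongr; exact Finset.card_union_le _ _)
  have hA : ∀ i, i ∉ A → eval (v i) D = 0 := fun i hi => by simpa [A] using hi
  have hbez := four_mul_card_add_card_le hv hF' hG' hF'0 hG'0 hrel hFs hGs hAB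
    (fun i hi => (Finset.mem_filter.mp hi).2) (fun i hi => (Finset.mem_filter.mp hi).2.2)
  obtain h0 | h0 := eq_or_ne d 0
  · have hAuniv : A = Finset.univ := Finset.filter_true_of_mem fun i _ =>
      eval_ne_zero_of_isHomogeneous_zero (h0 ▸ hD) hD0
    rw [hAuniv, h0, Finset.card_univ, Fintype.card_fin] at hbez
    omega
  have hS := (two_mul_card_le_or_exists_mul_self_dvd hv h0 hD hD0 S
    fun i hi => (Finset.mem_filter.mp hi).2).resolve_right (by
      rintro ⟨E, hE, hED⟩
      refine not_mul_self_dvd h3 hD hD0 (by omega) hA (B := B) (fun i hi hi' => ?_) hbez E hE hED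
      by_contra hsing
      exact hi' (Finset.mem_filter.mpr ⟨Finset.mem_univ i, hA i hi, hsing⟩))
  have hAge := choose_le_card h3 hD hD0 (show d + (3 - d) = 3 by omega) hA
  have hN := two_mul_choose_add_two (3 - d)
  have hM := two_mul_choose_add_two (7 - d)
  have hAle : A.card ≤ (3 - d + 2).choose 2 := by
    obtain h | h | h : d = 1 ∨ d = 2 ∨ d = 3 := by omega
    all_goals
      rw [h] at hbez hS hN ⊢
      omega
  have hmain := finrank_singularMultiples_add_le hD (show d + (3 - d) * 2 + 1 = 7 - d by omega) A B
    (fun i hi => (Finset.mem_filter.mp hi).2) (fun i hi => (Finset.mem_filter.mp hi).2.1)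
    (fun i hi => (Finset.mem_filter.mp hi).2.2)
    (exists_separator_of_card_le h3 hD hD0 (by omega) hA hAle) (fun i _ => by
      obtain ⟨f, hf, hfi, hfj⟩ := h4 i
      obtain ⟨l, hl, hli⟩ := exists_linear_eval_ne_zero (hv.1 i)
      refine ⟨f * l ^ (3 - d), ?_, by simp [hfi, hli], fun j _ hji => by simp [hfj j hji]⟩
      have := hf.mul (hl.pow (3 - d))
      rwa [show 4 + 1 * (3 - d) = 7 - d by omega] at this)
  obtain h | h | h : d = 1 ∨ d = 2 ∨ d = 3 := by omega
  all_goals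
    rw [h] at hmain hbez hS hAge hW hN hM
    omega

end DoublePoints

section Ideals

variable {k : Type} [Field k] {s : ℕ} (P : Fin s → Projectivization k (Fin 3 → k))

theorem areSeparated_rep (hinj : Function.Injective P) : AreSeparated fun i => (P i).rep := by
  refine ⟨fun i => (P i).rep_nonzero, fun i j hij => ?_⟩
  by_contra! hcon
  obtain ⟨a, ha⟩ := Function.ne_iff.mp (P j).rep_nonzero
  rw [Pi.zero_apply] at ha
  refine hij (hinj ?_)
  rw [← (P i).mk_rep, ← (P j).mk_rep, Projectivization.mk_eq_mk_iff']
  refine ⟨(P i).rep a / (P j).rep a, funext fun b => ?_⟩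
  have h := hcon (C ((P j).rep a) * X b - C ((P j).rep b) * X a)
    ((isHomogeneous_C_mul_X _ _).sub (isHomogeneous_C_mul_X _ _)) (by simp [mul_comm])
  simp only [map_sub, map_mul, eval_C, eval_X] at h
  rw [Pi.smul_apply, smul_eq_mul]
  field_simp
  linear_combination -h

theorem idealOfPoints_inf_homogeneousSubmodule (t : ℕ) :
    (idealOfPoints k P).restrictScalars k ⊓ homogeneousSubmodule (Fin 3) k t =
      homogeneousSubmodule (Fin 3) k t ⊓ ⨅ i, LinearMap.ker (evalAt (P i).rep) := by
  ext f
  simp only [Submodule.mem_inf, Submodule.restrictScalars_mem, idealOfPoints, Submodule.mem_iInf,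
    mem_homogeneousSubmodule, LinearMap.mem_ker, evalAt_apply]
  exact ⟨fun h => ⟨h.2, fun i => eval_eq_zero_of_mem_pointIdeal _ (h.1 i)⟩,
    fun h => ⟨fun i => mem_pointIdeal_of_eval_eq_zero _ h.1 (h.2 i), h.1⟩⟩

theorem doubleIdealOfPoints_inf_homogeneousSubmodule (t : ℕ) :
    (doubleIdealOfPoints k P).restrictScalars k ⊓ homogeneousSubmodule (Fin 3) k t =
      singularMultiples (fun i => (P i).rep) 1 t := by
  ext f
  simp only [Submodule.mem_inf, Submodule.restrictScalars_mem, doubleIdealOfPoints,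
    Submodule.mem_iInf, mem_homogeneousSubmodule]
  refine ⟨fun h => ⟨h.2, fun i => ?_⟩, fun h => ⟨fun i => ?_, h.1⟩⟩
  · rw [one_mul]
    exact isSingularAt_of_mem_pointIdeal_sq _ (h.1 i)
  · exact mem_pointIdeal_sq_of_isSingularAt _ h.1 (by simpa using h.2 i)

end Ideals

/-- For 11 points of ℙ² with generic Hilbert function, if H_{2X}(6) = 27 then
H_{2X}(7) ≥ 31. -/
theorem statement4 (k : Type) [Field k] [IsAlgClosed k] [CharZero k]
    (P : Fin 11 → Projectivization k (Fin 3 → k)) (hinj : Function.Injective P)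
    (hgen : HasGenericHilbertFunction k P)
    (h6 : hilbertFunction k (doubleIdealOfPoints k P) 6 = 27) :
    31 ≤ hilbertFunction k (doubleIdealOfPoints k P) 7 := by
  let v : Fin 11 → Fin 3 → k := fun i => (P i).rep
  have hX : ∀ t, (t + 2).choose 2 - Module.finrank k ↥(homogeneousSubmodule (Fin 3) k t ⊓
      ⨅ i, LinearMap.ker (evalAt (v i))) = min 11 ((t + 2).choose 2) := fun t => by
    rw [← hgen t, hilbertFunction, idealOfPoints_inf_homogeneousSubmodule,
      finrank_homogeneousSubmodule_fin_three]
  have h2X : ∀ t, hilbertFunction k (doubleIdealOfPoints k P) t =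
      (t + 2).choose 2 - Module.finrank k (singularMultiples v 1 t) := fun t => by
    rw [hilbertFunction, doubleIdealOfPoints_inf_homogeneousSubmodule,
      finrank_homogeneousSubmodule_fin_three]
  have h3 : ∀ f : MvPolynomial (Fin 3) k, f.IsHomogeneous 3 → (∀ i, eval (v i) f = 0) → f = 0 := by
    intro f hf hfv
    have h := hX 3
    rw [show Nat.choose (3 + 2) 2 = 10 from rfl] at h
    have : FiniteDimensional k ↥(homogeneousSubmodule (Fin 3) k 3 ⊓
      ⨅ i, LinearMap.ker (evalAt (v i))) := Submodule.finiteDimensional_of_le inf_le_left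
    have h0 := Submodule.finrank_eq_zero.mp (show Module.finrank k
      ↥(homogeneousSubmodule (Fin 3) k 3 ⊓ ⨅ i, LinearMap.ker (evalAt (v i))) = 0 by omega)
    rw [← Submodule.mem_bot k, ← h0]
    simpa using ⟨hf, hfv⟩
  have h4 : ∀ i, ∃ f : MvPolynomial (Fin 3) k, f.IsHomogeneous 4 ∧ eval (v i) f ≠ 0 ∧
      ∀ j, j ≠ i → eval (v j) f = 0 := by
    intro i
    have h := hX 4
    rw [show Nat.choose (4 + 2) 2 = 15 from rfl] at h
    obtain ⟨f, hf, hfi, hfj⟩ := exists_separator (fun i => evalAt (v i))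
      (homogeneousSubmodule (Fin 3) k 4) (by
        rw [Fintype.card_fin, finrank_homogeneousSubmodule_fin_three,
          show Nat.choose (4 + 2) 2 = 15 from rfl]
        omega) i
    rw [evalAt_apply] at hfi
    exact ⟨f, hf, hfi ▸ one_ne_zero, fun j hj => by simpa using hfj j hj⟩
  rw [h2X, show Nat.choose (6 + 2) 2 = 28 from rfl] at h6
  rw [h2X, show Nat.choose (7 + 2) 2 = 36 from rfl]
  have := finrank_singularMultiples_le_five (areSeparated_rep P hinj) h3 h4 (by
    change Module.finrank k (singularMultiples v 1 6) = 1
    omega)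
  change Module.finrank k (singularMultiples v 1 7) ≤ 5 at this
  omega
end

section
/- Let X be a set of 11 distinct points of P^2 with generic Hilbert function. Then H_{2X}(6) ≥ 26; equivalently, dim_k (I_{2X})_6 ≤ 2. -/
open MvPolynomial

section LowMonomials

/-- The exponents of the monomials of degree `< n` in two variables. -/
def lowMonomials (n : ℕ) : Finset (Fin 2 →₀ ℕ) :=
  (Finset.range n).biUnion fun j => Finset.finsuppAntidiag Finset.univ j

theorem mem_lowMonomials {n : ℕ} {d : Fin 2 →₀ ℕ} : d ∈ lowMonomials n ↔ d.degree < n := by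
  simp [lowMonomials, Finset.mem_finsuppAntidiag, Finsupp.degree_eq_sum]

theorem card_lowMonomials (n : ℕ) : (lowMonomials n).card = (n + 1).choose 2 := by
  rw [lowMonomials, Finset.card_biUnion]
  · simp only [Finset.card_finsuppAntidiag_nat_eq_choose, Finset.card_univ, Fintype.card_fin]
    induction n with
    | zero => simp
    | succ n ih =>
      rw [Finset.sum_range_succ, ih, show 2 + n - 1 = n + 1 by omega, Nat.choose_succ_self_right,
        Nat.choose_succ_succ' (n + 1) 1, Nat.choose_one_right, add_comm]
  · intro i _ j _ hij
    rw [Function.onFun, Finset.disjoint_left]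
    intro d hi hj
    rw [Finset.mem_finsuppAntidiag] at hi hj
    exact hij (hi.1.symm.trans hj.1)

theorem finrank_restrictTotalDegree (k : Type*) [Field k] (N : ℕ) :
    Module.finrank k (restrictTotalDegree (Fin 2) k N) = (N + 2).choose 2 := by
  have h : {n : Fin 2 →₀ ℕ | (n.sum fun _ e => e) ≤ N} = lowMonomials (N + 1) := by
    ext d
    simp only [Set.mem_ofPred_eq, Finset.mem_coe, mem_lowMonomials, Nat.lt_succ_iff]
    rfl
  rw [restrictTotalDegree, h, Module.finrank_eq_card_basis (basisRestrictSupport k _)]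
  simp [card_lowMonomials]

instance (k : Type*) [Field k] (N : ℕ) :
    Module.Finite k (restrictTotalDegree (Fin 2) k N) :=
  Module.finite_of_finrank_pos (by
    rw [finrank_restrictTotalDegree]; exact Nat.choose_pos (by omega))

theorem finrank_homogeneousSubmodule (k : Type*) [Field k] (t : ℕ) :
    Module.finrank k (homogeneousSubmodule (Fin 3) k t) = (t + 2).choose 2 := by
  have h : {d : Fin 3 →₀ ℕ | d.degree = t} =
      ↑(Finset.finsuppAntidiag (Finset.univ : Finset (Fin 3)) t) := by
    ext d
    simp [Finset.mem_finsuppAntidiag, Finsupp.degree_eq_sum]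
  rw [homogeneousSubmodule_eq_finsupp_supported, h,
    show AddMonoidAlgebra.supported k k _ = restrictSupport k _ from rfl,
    Module.finrank_eq_card_basis (basisRestrictSupport k _)]
  simp only [Finset.coe_sort_coe, Fintype.card_coe, Finset.card_finsuppAntidiag_nat_eq_choose,
    Finset.card_univ, Fintype.card_fin]
  rw [show 3 + t - 1 = t + 2 by omega, Nat.choose_symm_add]

instance (k : Type*) [Field k] (t : ℕ) :
    Module.Finite k (homogeneousSubmodule (Fin 3) k t) :=
  Module.finite_of_finrank_pos (by
    rw [finrank_homogeneousSubmodule]; exact Nat.choose_pos (by omega))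

end LowMonomials

section Jets

variable {k : Type*} [Field k]

/-- The automorphism of the polynomial ring that moves the point `p` to the origin. -/
noncomputable def translateEquiv (p : Fin 2 → k) :
    MvPolynomial (Fin 2) k ≃ₐ[k] MvPolynomial (Fin 2) k :=
  AlgEquiv.ofAlgHom (aeval fun i => X i + C (p i)) (aeval fun i => X i - C (p i))
    (by ext i; simp) (by ext i; simp)

theorem translateEquiv_X (p : Fin 2 → k) (i : Fin 2) :
    translateEquiv p (X i) = X i + C (p i) := by
  simp [translateEquiv]

/-- The ideal of polynomials vanishing at `p`. -/
noncomputable def vanishingAt (p : Fin 2 → k) : Ideal (MvPolynomial (Fin 2) k) :=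
  RingHom.ker (eval p)

theorem mem_vanishingAt {p : Fin 2 → k} {f : MvPolynomial (Fin 2) k} :
    f ∈ vanishingAt p ↔ eval p f = 0 := RingHom.mem_ker

theorem eval_zero_translateEquiv (p : Fin 2 → k) (f : MvPolynomial (Fin 2) k) :
    eval 0 (translateEquiv p f) = eval p f := by
  have : (aeval (0 : Fin 2 → k)).comp (translateEquiv p).toAlgHom = aeval p := by
    ext i
    simp [translateEquiv_X]
  simpa [aeval_eq_eval] using DFunLike.congr_fun this f

theorem vanishingAt_eq_comap (p : Fin 2 → k) :
    vanishingAt p = (idealOfVars (Fin 2) k).comap (translateEquiv p) := by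
  ext f
  rw [Ideal.mem_comap, mem_vanishingAt, ← eval_zero_translateEquiv,
    ← pow_one (idealOfVars (Fin 2) k), mem_pow_idealOfVars_iff']
  simp [eval_zero, constantCoeff_eq, Finsupp.degree_eq_zero_iff]

theorem mem_vanishingAt_pow {p : Fin 2 → k} {n : ℕ} {f : MvPolynomial (Fin 2) k} :
    f ∈ vanishingAt p ^ n ↔ translateEquiv p f ∈ idealOfVars (Fin 2) k ^ n := by
  have h : vanishingAt p = (idealOfVars (Fin 2) k).map (translateEquiv p).symm := by
    rw [vanishingAt_eq_comap]
    exact (Ideal.map_symm (I := idealOfVars (Fin 2) k) (translateEquiv p).toRingEquiv).symm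
  rw [h, ← Ideal.map_pow]
  have := Ideal.map_symm (I := idealOfVars (Fin 2) k ^ n) (translateEquiv p).toRingEquiv
  change f ∈ Ideal.map (translateEquiv p).toRingEquiv.symm _ ↔ _
  rw [this]
  rfl

instance vanishingAt_isMaximal (p : Fin 2 → k) : (vanishingAt p).IsMaximal :=
  RingHom.ker_isMaximal_of_surjective _ fun c => ⟨C c, eval_C _⟩

theorem vanishingAt_injective : Function.Injective (vanishingAt : (Fin 2 → k) → _) := by
  intro p q h
  ext i
  have : X i - C (p i) ∈ vanishingAt p := by simp [mem_vanishingAt]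
  rw [h, mem_vanishingAt] at this
  simpa [sub_eq_zero, eq_comm] using this

/-- The jet of order `< n` of a polynomial at `p`. -/
noncomputable def jet (p : Fin 2 → k) (n : ℕ) :
    MvPolynomial (Fin 2) k →ₗ[k] (lowMonomials n → k) :=
  LinearMap.pi fun d => lcoeff k d.1 ∘ₗ (translateEquiv p).toLinearMap

theorem jet_eq_zero_iff {p : Fin 2 → k} {n : ℕ} {f : MvPolynomial (Fin 2) k} :
    jet p n f = 0 ↔ f ∈ vanishingAt p ^ n := by
  rw [mem_vanishingAt_pow, mem_pow_idealOfVars_iff', funext_iff]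
  simp [jet, mem_lowMonomials]

theorem jet_surjective (p : Fin 2 → k) (n : ℕ) : Function.Surjective (jet p n) := by
  intro c
  refine ⟨(translateEquiv p).symm (∑ d : lowMonomials n, monomial d.1 (c d)), ?_⟩
  ext e
  simp [jet, coeff_monomial]

/-- The jets of orders `< n i` at the points `p i`. -/
noncomputable def multijet {ι : Type*} (p : ι → Fin 2 → k) (n : ι → ℕ) :
    MvPolynomial (Fin 2) k →ₗ[k] (∀ i, lowMonomials (n i) → k) :=
  LinearMap.pi fun i => jet (p i) (n i)

theorem multijet_eq_zero_iff {ι : Type*} {p : ι → Fin 2 → k} {n : ι → ℕ}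
    {f : MvPolynomial (Fin 2) k} :
    multijet p n f = 0 ↔ ∀ i, f ∈ vanishingAt (p i) ^ n i := by
  simp only [← jet_eq_zero_iff]
  exact funext_iff

theorem multijet_surjective {ι : Type*} [Finite ι] {p : ι → Fin 2 → k}
    (hp : Function.Injective p) (n : ι → ℕ) : Function.Surjective (multijet p n) := by
  intro c
  choose r hr using fun i => jet_surjective (p i) (n i) (c i)
  obtain ⟨f, hf⟩ := Ideal.pi_quotient_surjective (I := fun i => vanishingAt (p i) ^ n i)
    (fun i j hij => IsCoprime.pow <| Ideal.isCoprime_of_isMaximal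
      fun h => hij (hp (vanishingAt_injective h))) fun i => Ideal.Quotient.mk _ (r i)
  refine ⟨f, funext fun i => ?_⟩
  rw [← hr i, ← sub_eq_zero]
  change jet (p i) (n i) f - _ = 0
  rw [← map_sub, jet_eq_zero_iff]
  exact Ideal.Quotient.eq.1 (hf i)

theorem finrank_multijet_target {ι : Type*} [Fintype ι] (n : ι → ℕ) :
    Module.finrank k (∀ i, lowMonomials (n i) → k) = ∑ i, (n i + 1).choose 2 := by
  simp [Module.finrank_pi_fintype, card_lowMonomials]

end Jets

section Bezout

theorem choose_add_mul_identity (a b : ℕ) :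
    (a + b + 1).choose 2 = (a + 1).choose 2 + (b + 1).choose 2 + a * b := by
  induction b with
  | zero => simp
  | succ b ih =>
    rw [← add_assoc a b 1, Nat.choose_succ_succ' (a + b + 1) 1, Nat.choose_one_right, ih,
      Nat.choose_succ_succ' (b + 1) 1, Nat.choose_one_right]
    ring

theorem choose_bezout_identity (M d e : ℕ) :
    (M + d + e + 2).choose 2 + (M + 2).choose 2 =
      (M + e + 2).choose 2 + (M + d + 2).choose 2 + d * e := by
  have h₁ := choose_add_mul_identity (M + d + 1) e
  have h₂ := choose_add_mul_identity (M + 1) e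
  rw [show M + d + 1 + e + 1 = M + d + e + 2 by ring] at h₁
  rw [show M + 1 + e + 1 = M + e + 2 by ring] at h₂
  rw [h₁, h₂]
  ring

theorem finrank_range_le_of_ker_le {k V W Q : Type*} [Field k] [AddCommGroup V] [Module k V]
    [AddCommGroup W] [Module k W] [AddCommGroup Q] [Module k Q] [Module.Finite k W]
    (g : V →ₗ[k] W) (h : V →ₗ[k] Q) (hgh : LinearMap.ker g ≤ LinearMap.ker h) :
    Module.finrank k (LinearMap.range h) ≤ Module.finrank k W := by
  have : Module.Finite k (V ⧸ LinearMap.ker g) :=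
    Module.Finite.equiv g.quotKerEquivRange.symm
  rw [← Submodule.range_liftQ _ h hgh]
  calc _ ≤ Module.finrank k (V ⧸ LinearMap.ker g) := LinearMap.finrank_range_le _
    _ = Module.finrank k (LinearMap.range g) := g.quotKerEquivRange.finrank_eq
    _ ≤ _ := Submodule.finrank_le _

theorem finrank_add_finrank_map_le {k V Q : Type*} [Field k] [AddCommGroup V] [Module k V]
    [AddCommGroup Q] [Module k Q] (g : V →ₗ[k] Q) {A B : Submodule k V} [Module.Finite k B]
    (hAB : A ≤ B) :
    Module.finrank k A + Module.finrank k (B.map g) ≤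
      Module.finrank k B + Module.finrank k (A.map g) := by
  have : Module.Finite k A := Submodule.finiteDimensional_of_le hAB
  have hA := LinearMap.finrank_range_add_finrank_ker (g.domRestrict A)
  have hB := LinearMap.finrank_range_add_finrank_ker (g.domRestrict B)
  rw [LinearMap.range_domRestrict] at hA hB
  have hker : Module.finrank k (LinearMap.ker (g.domRestrict A)) ≤
      Module.finrank k (LinearMap.ker (g.domRestrict B)) := by
    refine LinearMap.finrank_le_finrank_of_injective
      (f := (Submodule.inclusion hAB).restrict (q := LinearMap.ker (g.domRestrict B)) ?_) ?_
    · intro x hx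
      exact hx
    · intro x y hxy
      ext
      have := congrArg (fun z => (z.1.1 : V)) hxy
      exact this
  omega

variable {k : Type*} [Field k]

theorem exists_map_restrictTotalDegree_eq_top {Q : Type*} [AddCommGroup Q] [Module k Q]
    [Module.Finite k Q] (g : MvPolynomial (Fin 2) k →ₗ[k] Q) (hg : Function.Surjective g) :
    ∃ N₀, ∀ N ≥ N₀, (restrictTotalDegree (Fin 2) k N).map g = ⊤ := by
  choose r hr using fun i => hg (Module.finBasis k Q i)
  refine ⟨Finset.univ.sup fun i => (r i).totalDegree, fun N hN => ?_⟩
  rw [eq_top_iff, ← (Module.finBasis k Q).span_eq, Submodule.span_le]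
  rintro _ ⟨i, rfl⟩
  refine ⟨r i, (mem_restrictTotalDegree _ _ _).2 ((Finset.le_sup (f := fun i =>
    (r i).totalDegree) (Finset.mem_univ i)).trans hN), hr i⟩

/-- The combinations `u * f + v * g` with `u` and `v` of bounded degree. -/
noncomputable def combination (f g : MvPolynomial (Fin 2) k) (m n : ℕ) :
    restrictTotalDegree (Fin 2) k m × restrictTotalDegree (Fin 2) k n →ₗ[k]
      MvPolynomial (Fin 2) k :=
  (LinearMap.mulRight k f ∘ₗ Submodule.subtype _).coprod
    (LinearMap.mulRight k g ∘ₗ Submodule.subtype _)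

theorem finrank_ker_combination_le {f g : MvPolynomial (Fin 2) k} (hg : g ≠ 0)
    (hfg : IsRelPrime f g) (M n : ℕ) :
    Module.finrank k (LinearMap.ker (combination f g (M + g.totalDegree) n)) ≤
      (M + 2).choose 2 := by
  set K := LinearMap.ker (combination f g (M + g.totalDegree) n)
  let φ : K →ₗ[k] MvPolynomial (Fin 2) k :=
    Submodule.subtype _ ∘ₗ LinearMap.fst k _ _ ∘ₗ K.subtype
  have hφ : Function.Injective φ := by
    rw [injective_iff_map_eq_zero]
    rintro ⟨⟨⟨u, hu⟩, ⟨v, hv⟩⟩, h⟩ hu0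
    obtain rfl : u = 0 := hu0
    have h' : (0 : MvPolynomial (Fin 2) k) * f + v * g = 0 := h
    have hv0 : v = 0 := by simpa [hg] using h'
    subst hv0
    rfl
  rw [← LinearMap.finrank_range_of_inj hφ, ← finrank_restrictTotalDegree k M]
  refine le_trans (Submodule.finrank_mono ?_)
    (Submodule.finrank_map_le (LinearMap.mulLeft k g) (restrictTotalDegree (Fin 2) k M))
  rintro _ ⟨⟨⟨⟨u, hu⟩, ⟨v, hv⟩⟩, h⟩, rfl⟩
  have h' : u * f + v * g = 0 := h
  change u ∈ _
  have hdvd : g ∣ u := hfg.symm.dvd_of_dvd_mul_right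
    ⟨-v, by linear_combination h'⟩
  obtain ⟨c, rfl⟩ := hdvd
  refine ⟨c, ?_, rfl⟩
  rw [SetLike.mem_coe, mem_restrictTotalDegree]
  rw [mem_restrictTotalDegree] at hu
  rcases eq_or_ne c 0 with rfl | hc
  · simp
  · rw [totalDegree_mul_of_isDomain hg hc] at hu
    omega

/-- **Bézout's inequality** for two plane curves without common component having prescribed
multiplicities at given points of the affine plane. -/
theorem sum_multiplicity_mul_le {ι : Type*} [Fintype ι] {p : ι → Fin 2 → k}
    (hp : Function.Injective p) {f g : MvPolynomial (Fin 2) k} (hg : g ≠ 0)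
    (hfg : IsRelPrime f g) {a b : ι → ℕ} (ha : ∀ i, f ∈ vanishingAt (p i) ^ a i)
    (hb : ∀ i, g ∈ vanishingAt (p i) ^ b i) :
    ∑ i, a i * b i ≤ f.totalDegree * g.totalDegree := by
  set d := f.totalDegree with hd
  set e := g.totalDegree with he
  set π := multijet (k := k) p fun i => a i + b i with hπ
  obtain ⟨M, hM⟩ := exists_map_restrictTotalDegree_eq_top π (multijet_surjective hp _)
  set W := LinearMap.range (combination f g (M + e) (M + d)) with hWdef
  have hW : (M + e + 2).choose 2 + (M + d + 2).choose 2 ≤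
      Module.finrank k W + (M + 2).choose 2 := by
    have h := LinearMap.finrank_range_add_finrank_ker (combination f g (M + e) (M + d))
    rw [Module.finrank_prod, finrank_restrictTotalDegree, finrank_restrictTotalDegree] at h
    rw [← h]
    gcongr
    exact finrank_ker_combination_le hg hfg M _
  have hWle : W ≤ restrictTotalDegree (Fin 2) k (M + d + e) := by
    rintro _ ⟨⟨⟨u, hu⟩, ⟨v, hv⟩⟩, rfl⟩
    change u * f + v * g ∈ _
    rw [mem_restrictTotalDegree] at hu hv ⊢
    refine (totalDegree_add _ _).trans (max_le ?_ ?_)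
    · exact (totalDegree_mul _ _).trans (by omega)
    · exact (totalDegree_mul _ _).trans (by omega)
  have hf : Module.finrank k (LinearMap.range (π ∘ₗ LinearMap.mulRight k f)) ≤
      ∑ i, (b i + 1).choose 2 := by
    rw [← finrank_multijet_target (k := k) b]
    refine finrank_range_le_of_ker_le (multijet p b) _ fun u hu => ?_
    rw [LinearMap.mem_ker, multijet_eq_zero_iff] at hu
    rw [LinearMap.mem_ker, LinearMap.comp_apply, hπ, multijet_eq_zero_iff]
    intro i
    rw [add_comm, pow_add]
    exact Ideal.mul_mem_mul (hu i) (ha i)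
  have hg : Module.finrank k (LinearMap.range (π ∘ₗ LinearMap.mulRight k g)) ≤
      ∑ i, (a i + 1).choose 2 := by
    rw [← finrank_multijet_target (k := k) a]
    refine finrank_range_le_of_ker_le (multijet p a) _ fun u hu => ?_
    rw [LinearMap.mem_ker, multijet_eq_zero_iff] at hu
    rw [LinearMap.mem_ker, LinearMap.comp_apply, hπ, multijet_eq_zero_iff]
    intro i
    rw [pow_add]
    exact Ideal.mul_mem_mul (hu i) (hb i)
  have hπW : Module.finrank k (W.map π) ≤
      ∑ i, (b i + 1).choose 2 + ∑ i, (a i + 1).choose 2 := by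
    refine le_trans (Submodule.finrank_mono (t := LinearMap.range (π ∘ₗ LinearMap.mulRight k f) ⊔
      LinearMap.range (π ∘ₗ LinearMap.mulRight k g)) ?_)
      ((Submodule.finrank_add_le_finrank_add_finrank _ _).trans (add_le_add hf hg))
    rintro _ ⟨_, ⟨⟨⟨u, hu⟩, ⟨v, hv⟩⟩, rfl⟩, rfl⟩
    change π (u * f + v * g) ∈ _
    rw [map_add]
    exact Submodule.add_mem_sup ⟨u, rfl⟩ ⟨v, rfl⟩
  have hmain := finrank_add_finrank_map_le π hWle
  rw [hM _ (by omega), finrank_top, finrank_multijet_target,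
    finrank_restrictTotalDegree] at hmain
  have hsum : ∑ i, (a i + b i + 1).choose 2 =
      ∑ i, (a i + 1).choose 2 + ∑ i, (b i + 1).choose 2 + ∑ i, a i * b i := by
    simp only [choose_add_mul_identity, Finset.sum_add_distrib]
  have := choose_bezout_identity M d e
  omega

end Bezout

section Factorization

variable {k : Type*} [Field k]

theorem totalDegree_pos_of_not_isUnit {σ : Type*} {f : MvPolynomial σ k} (hf : f ≠ 0)
    (hu : ¬IsUnit f) : 0 < f.totalDegree := by
  rw [Nat.pos_iff_ne_zero]
  intro h
  rw [totalDegree_eq_zero_iff_eq_C] at h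
  refine hu (h ▸ ((isUnit_iff_ne_zero.2 fun hc => hf ?_).map C))
  rw [h, hc, C_0]

theorem exists_sq_mul_squarefree {σ : Type*} (f : MvPolynomial σ k) (hf : f ≠ 0) :
    ∃ S T : MvPolynomial σ k, f = S ^ 2 * T ∧ Squarefree T := by
  induction hn : f.totalDegree using Nat.strong_induction_on generalizing f with
  | _ n ih =>
    by_cases hsq : Squarefree f
    · exact ⟨1, f, by ring, hsq⟩
    · simp only [Squarefree, not_forall] at hsq
      obtain ⟨x, ⟨g, rfl⟩, hxu⟩ := hsq
      have hx : x ≠ 0 := by rintro rfl; simp at hf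
      have hg : g ≠ 0 := by rintro rfl; simp at hf
      have hpos := totalDegree_pos_of_not_isUnit hx hxu
      rw [totalDegree_mul_of_isDomain (mul_ne_zero hx hx) hg,
        totalDegree_mul_of_isDomain hx hx] at hn
      obtain ⟨S, T, rfl, hT⟩ := ih _ (by omega) g hg rfl
      exact ⟨x * S, T, by ring, hT⟩

theorem exists_common_factor {σ ι : Type*} (F : ι → MvPolynomial σ k) (i₀ : ι)
    (hF : F i₀ ≠ 0) :
    ∃ (D : MvPolynomial σ k) (G : ι → MvPolynomial σ k), (∀ i, F i = D * G i) ∧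
      ∀ q, Irreducible q → ¬∀ i, q ∣ G i := by
  induction hn : (F i₀).totalDegree using Nat.strong_induction_on generalizing F with
  | _ n ih =>
    by_cases h : ∀ q, Irreducible q → ¬∀ i, q ∣ F i
    · exact ⟨1, F, by simp, h⟩
    · push Not at h
      obtain ⟨q, hq, hqF⟩ := h
      choose G hG using hqF
      have hG0 : G i₀ ≠ 0 := by
        intro h0
        exact hF (by rw [hG, h0, mul_zero])
      have hpos := totalDegree_pos_of_not_isUnit hq.ne_zero hq.not_isUnit
      rw [hG, totalDegree_mul_of_isDomain hq.ne_zero hG0] at hn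
      obtain ⟨D, H, hH, hirr⟩ := ih _ (by omega) G hG0 rfl
      exact ⟨q * D, H, fun i => by rw [hG, hH, mul_assoc], hirr⟩

theorem exists_isRelPrime_add_C_mul {σ : Type*} [Infinite k] {F A B : MvPolynomial σ k}
    (hF : F ≠ 0) (h : ∀ q, Irreducible q → q ∣ F → q ∣ A → ¬q ∣ B) :
    ∃ c : k, IsRelPrime F (A + C c * B) := by
  by_contra! hcon
  have hq : ∀ c : k, ∃ q ∈ UniqueFactorizationMonoid.factors F, q ∣ A + C c * B := by
    intro c
    by_contra! hno
    refine hcon c (WfDvdMonoid.isRelPrime_of_no_irreducible_factors (by simp [hF])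
      fun q hq hqF hqA => ?_)
    obtain ⟨r, hr, hqr⟩ := UniqueFactorizationMonoid.exists_mem_factors_of_dvd hF hq hqF
    exact hno r hr (hqr.dvd_iff_dvd_left.1 hqA)
  choose q hqF hqd using hq
  classical
  obtain ⟨c, c', hne, heq⟩ := Finite.exists_ne_map_eq_of_infinite
    fun c => (⟨q c, Multiset.mem_toFinset.2 (hqF c)⟩ :
      (UniqueFactorizationMonoid.factors F).toFinset)
  have heq : q c = q c' := congrArg Subtype.val heq
  have hB : q c ∣ B := by
    have h₁ : q c ∣ C (c - c') * B := by
      have := dvd_sub (hqd c) (heq ▸ hqd c')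
      rwa [show A + C c * B - (A + C c' * B) = C (c - c') * B by rw [C_sub]; ring] at this
    exact ((isUnit_iff_ne_zero.2 (sub_ne_zero.2 hne)).map C).dvd_mul_left.1 h₁
  exact h _ (UniqueFactorizationMonoid.irreducible_of_factor _ (hqF c))
    (UniqueFactorizationMonoid.dvd_of_mem_factors (hqF c))
    ((dvd_add_left (hB.mul_left _)).1 (hqd c)) hB

end Factorization

section Derivative

variable {k : Type*} [Field k]

theorem totalDegree_pderiv_le {σ : Type*} (i : σ) (f : MvPolynomial σ k) :
    (pderiv i f).totalDegree ≤ f.totalDegree - 1 := by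
  rw [totalDegree, Finset.sup_le_iff]
  intro m hm
  have hm' : m + Finsupp.single i 1 ∈ f.support := by
    rw [mem_support_iff, coeff_pderiv] at hm
    exact mem_support_iff.2 (left_ne_zero_of_mul hm)
  have := le_totalDegree hm'
  change (m + Finsupp.single i 1).degree ≤ _ at this
  change m.degree ≤ _
  rw [map_add, Finsupp.degree_single] at this
  omega

theorem totalDegree_eq_zero_of_pderiv_eq_zero {σ : Type*} [CharZero k] {f : MvPolynomial σ k}
    (h : ∀ i, pderiv i f = 0) : f.totalDegree = 0 := by
  rw [totalDegree_eq_zero_iff]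
  intro m hm i
  by_contra hi
  have hle : Finsupp.single i 1 ≤ m := by
    rw [Finsupp.single_le_iff]
    omega
  have h₁ := coeff_pderiv (i := i) f (m - Finsupp.single i 1)
  rw [h i, tsub_add_cancel_of_le hle, coeff_zero] at h₁
  rcases mul_eq_zero.1 h₁.symm with h₂ | h₂
  · exact mem_support_iff.1 hm h₂
  · exact Nat.cast_add_one_ne_zero _ h₂

theorem Derivation.apply_mem_of_mem_sq {R A : Type*} [CommRing R] [CommRing A] [Algebra R A]
    (δ : Derivation R A A) {I : Ideal A} {f : A} (hf : f ∈ I ^ 2) : δ f ∈ I := by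
  rw [pow_two] at hf
  refine Submodule.mul_induction_on hf (fun a ha b hb => ?_) fun a b ha hb => ?_
  · rw [δ.leibniz]
    exact I.add_mem (I.mul_mem_right _ ha) (I.mul_mem_right _ hb)
  · rw [map_add]
    exact I.add_mem ha hb

theorem not_forall_dvd_pderiv [CharZero k] {σ : Type*} {T q : MvPolynomial σ k}
    (hT : Squarefree T) (hq : Irreducible q) (hqT : q ∣ T) : ¬∀ i, q ∣ pderiv i T := by
  intro h
  obtain ⟨r, rfl⟩ := hqT
  have hqr : ¬q ∣ r := fun ⟨s, hs⟩ => hq.not_isUnit (hT q ⟨s, by rw [hs, mul_assoc]⟩)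
  refine (totalDegree_pos_of_not_isUnit hq.ne_zero hq.not_isUnit).ne'
    (totalDegree_eq_zero_of_pderiv_eq_zero fun i => ?_)
  by_contra hne
  have h₁ : q ∣ pderiv i q := by
    have h₂ := h i
    rw [pderiv_mul, dvd_add_left (dvd_mul_right _ _)] at h₂
    exact (hq.prime.dvd_or_dvd h₂).resolve_right hqr
  have h₂ := totalDegree_le_of_dvd_of_isDomain h₁ hne
  have h₃ := totalDegree_pderiv_le i q
  have h₄ := totalDegree_pos_of_not_isUnit hq.ne_zero hq.not_isUnit
  omega

/-- A reduced plane curve of degree `t` has at most `t * (t - 1) / 2` singular points. -/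
theorem two_mul_card_singular_le [CharZero k] {ι : Type*} [Fintype ι] {p : ι → Fin 2 → k}
    (hp : Function.Injective p) {T : MvPolynomial (Fin 2) k} (hT : Squarefree T)
    (h : ∀ i, T ∈ vanishingAt (p i) ^ 2) :
    2 * Fintype.card ι ≤ T.totalDegree * (T.totalDegree - 1) := by
  have hT0 : T ≠ 0 := hT.ne_zero
  obtain ⟨c, hc⟩ := exists_isRelPrime_add_C_mul (A := pderiv 0 T) (B := pderiv 1 T) hT0
    fun q hq hqT h₀ h₁ => not_forall_dvd_pderiv hT hq hqT
      (Fin.forall_fin_two.2 ⟨h₀, h₁⟩)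
  have hmem : ∀ i, pderiv 0 T + C c * pderiv 1 T ∈ vanishingAt (p i) ^ 1 := by
    intro i
    rw [pow_one]
    exact Ideal.add_mem _ (Derivation.apply_mem_of_mem_sq _ (h i))
      (Ideal.mul_mem_left _ _ (Derivation.apply_mem_of_mem_sq _ (h i)))
  have hdeg : (pderiv 0 T + C c * pderiv 1 T).totalDegree ≤ T.totalDegree - 1 := by
    refine (totalDegree_add _ _).trans (max_le (totalDegree_pderiv_le _ _) ?_)
    refine (totalDegree_mul _ _).trans ?_
    rw [totalDegree_C, zero_add]
    exact totalDegree_pderiv_le _ _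
  have := sum_multiplicity_mul_le hp hT0 hc.symm hmem h
  simp only [one_mul, Finset.sum_const, Finset.card_univ, smul_eq_mul] at this
  calc 2 * Fintype.card ι = Fintype.card ι * 2 := mul_comm _ _
    _ ≤ _ := this
    _ ≤ (T.totalDegree - 1) * T.totalDegree := Nat.mul_le_mul_right _ hdeg
    _ = _ := mul_comm _ _

theorem exists_curve_through {ι : Type*} (p : ι → Fin 2 → k) (s : Finset ι) {r : ℕ}
    (hs : s.card < (r + 2).choose 2) :
    ∃ f : MvPolynomial (Fin 2) k, f ≠ 0 ∧ f.totalDegree ≤ r ∧ ∀ i ∈ s, eval (p i) f = 0 := by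
  let φ : restrictTotalDegree (Fin 2) k r →ₗ[k] (s → k) :=
    LinearMap.pi fun i => (aeval (p i)).toLinearMap ∘ₗ Submodule.subtype _
  have hφ : LinearMap.ker φ ≠ ⊥ := by
    refine LinearMap.ker_ne_bot_of_finrank_lt ?_
    rwa [finrank_restrictTotalDegree, Module.finrank_fintype_fun_eq_card, Fintype.card_coe]
  obtain ⟨⟨f, hf⟩, hfφ, hf0⟩ := Submodule.exists_mem_ne_zero_of_ne_bot hφ
  refine ⟨f, fun h => hf0 (Subtype.ext h), (mem_restrictTotalDegree _ _ _).1 hf, fun i hi => ?_⟩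
  have := congrFun (LinearMap.mem_ker.1 hfφ) ⟨i, hi⟩
  rw [← aeval_eq_eval]
  exact this

end Derivative

section AffineSextics

variable {k : Type*} [Field k]

theorem mem_vanishingAt_pow_of_mul_mem {p : Fin 2 → k} {n : ℕ} {f g : MvPolynomial (Fin 2) k}
    (hf : eval p f ≠ 0) (hfg : f * g ∈ vanishingAt p ^ n) : g ∈ vanishingAt p ^ n := by
  have hcop : IsCoprime (Ideal.span {f}) (vanishingAt p ^ n) := by
    refine IsCoprime.pow_right ?_
    rw [Ideal.isCoprime_iff_sup_eq, sup_comm]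
    refine (vanishingAt_isMaximal p).1.2 _ (left_lt_sup.2 fun h => hf ?_)
    exact mem_vanishingAt.1 (h (Ideal.mem_span_singleton_self f))
  obtain ⟨u, hu, v, hv, huv⟩ := Ideal.isCoprime_iff_exists.1 hcop
  obtain ⟨w, rfl⟩ := Ideal.mem_span_singleton.1 hu
  have hg : g = w * (f * g) + g * v := by linear_combination (-g) * huv
  rw [hg]
  exact Ideal.add_mem _ (Ideal.mul_mem_left _ _ hfg) (Ideal.mul_mem_left _ _ hv)

theorem not_forall_eval_eq_zero_of_linearIndependent {G : Fin 3 → MvPolynomial (Fin 2) k}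
    (hG : LinearIndependent k G) (hdeg : ∀ j, (G j).totalDegree ≤ 1) (p : Fin 2 → k) :
    ¬∀ j, eval p (G j) = 0 := by
  intro h
  let G' : Fin 3 → restrictTotalDegree (Fin 2) k 1 :=
    fun j => ⟨G j, (mem_restrictTotalDegree _ _ _).2 (hdeg j)⟩
  have hG' : LinearIndependent k G' := LinearIndependent.of_comp (Submodule.subtype _) hG
  have htop := hG'.span_eq_top_of_card_eq_finrank' (by
    rw [finrank_restrictTotalDegree]; rfl)
  let ev : restrictTotalDegree (Fin 2) k 1 →ₗ[k] k :=
    (aeval p).toLinearMap ∘ₗ Submodule.subtype _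
  have hle : Submodule.span k (Set.range G') ≤ LinearMap.ker ev := by
    rw [Submodule.span_le]
    rintro _ ⟨j, rfl⟩
    change aeval p (G j) = 0
    rw [aeval_eq_eval]
    exact h j
  rw [htop] at hle
  have h1 := hle (x := ⟨1, (mem_restrictTotalDegree _ _ _).2 (by simp)⟩) trivial
  exact one_ne_zero ((map_one (aeval (R := k) p)).symm.trans h1)

theorem not_forall_totalDegree_eq_zero_of_linearIndependent
    {G : Fin 3 → MvPolynomial (Fin 2) k} (hG : LinearIndependent k G) :
    ¬∀ j, (G j).totalDegree ≤ 0 := by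
  intro hdeg
  let G' : Fin 3 → restrictTotalDegree (Fin 2) k 0 :=
    fun j => ⟨G j, (mem_restrictTotalDegree _ _ _).2 (hdeg j)⟩
  have hG' : LinearIndependent k G' := LinearIndependent.of_comp (Submodule.subtype _) hG
  have := hG'.fintype_card_le_finrank
  rw [finrank_restrictTotalDegree] at this
  simp at this

/-- The numerical constraints on a fixed component `S ^ 2 * T` of a net of sextics, with
`s = deg S` and `t = deg T`, are contradictory. -/
theorem not_numerically_admissible {n₀ n₁ n₂ s t : ℕ} (hsing : 2 * n₂ ≤ t * (t - 1))
    (hall : s = 0 → 11 ≤ n₀ + n₁ + n₂) (hres₀ : s + t ≤ 3 → (3 - (s + t) + 2).choose 2 ≤ n₀)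
    (hres : s ≤ 3 → (3 - s + 2).choose 2 ≤ n₀ + n₁ + n₂)
    (hbez : 4 * n₀ + n₁ ≤ (6 - (2 * s + t)) * (6 - (2 * s + t)))
    (hfive : 2 * s + t = 5 → n₀ + n₁ = 0) (hsix : 2 * s + t ≠ 6) (hle : 2 * s + t ≤ 6) :
    False := by
  have hs : s ≤ 3 := by omega
  have ht : t ≤ 6 := by omega
  simp only [Nat.choose_two_right] at hres₀ hres
  interval_cases s <;> interval_cases t <;> omega

open Classical in
/-- Three linearly independent curves of degree at most `6` cannot all be singular at `11` points
that do not lie on a cubic. -/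
theorem not_linearIndependent_of_singular [CharZero k] {p : Fin 11 → Fin 2 → k}
    (hp : Function.Injective p)
    (hcubic : ∀ g : MvPolynomial (Fin 2) k, g.totalDegree ≤ 3 → (∀ i, eval (p i) g = 0) → g = 0)
    {F : Fin 3 → MvPolynomial (Fin 2) k} (hdeg : ∀ j, (F j).totalDegree ≤ 6)
    (hF : ∀ j i, F j ∈ vanishingAt (p i) ^ 2) : ¬LinearIndependent k F := by
  intro hLI
  obtain ⟨D, G, hFG, hirr⟩ := exists_common_factor F 0 (hLI.ne_zero 0)
  have hD0 : D ≠ 0 := by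
    rintro rfl
    exact hLI.ne_zero 0 (by rw [hFG, zero_mul])
  have hGLI : LinearIndependent k G := by
    refine LinearIndependent.of_comp (LinearMap.mulLeft k D) ?_
    convert! hLI using 1
    exact funext fun j => (hFG j).symm
  obtain ⟨S, T, hST, hT⟩ := exists_sq_mul_squarefree D hD0
  have hT0 : T ≠ 0 := hT.ne_zero
  have hS0 : S ≠ 0 := by
    rintro rfl
    simp [hST] at hD0
  have hDdeg : D.totalDegree = 2 * S.totalDegree + T.totalDegree := by
    rw [hST, totalDegree_mul_of_isDomain (pow_ne_zero 2 hS0) hT0, pow_two,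
      totalDegree_mul_of_isDomain hS0 hS0, two_mul]
  have hGdeg : ∀ j, D.totalDegree + (G j).totalDegree ≤ 6 := fun j => by
    rw [← totalDegree_mul_of_isDomain hD0 (hGLI.ne_zero j), ← hFG]
    exact hdeg j
  set s := S.totalDegree with hs
  set t := T.totalDegree with ht
  -- the points according to their position with respect to the fixed component `D = S ^ 2 * T`
  set A₀ := Finset.univ.filter fun i => eval (p i) D ≠ 0 with hA₀
  set A₁ := Finset.univ.filter fun i => eval (p i) D = 0 ∧ D ∉ vanishingAt (p i) ^ 2 with hA₁
  set A₂ := Finset.univ.filter fun i => eval (p i) S ≠ 0 ∧ T ∈ vanishingAt (p i) ^ 2 with hA₂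
  have hcover : ∀ i, eval (p i) S ≠ 0 → i ∈ A₀ ∪ A₁ ∪ A₂ := by
    intro i hi
    simp only [hA₀, hA₁, hA₂, Finset.mem_union, Finset.mem_filter, Finset.mem_univ, true_and]
    by_cases h₀ : eval (p i) D = 0
    · by_cases h₁ : D ∈ vanishingAt (p i) ^ 2
      · refine Or.inr ⟨hi, mem_vanishingAt_pow_of_mul_mem (f := S ^ 2) ?_ (hST ▸ h₁)⟩
        rw [map_pow]
        exact pow_ne_zero 2 hi
      · exact Or.inl (Or.inr ⟨h₀, h₁⟩)
    · exact Or.inl (Or.inl h₀)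
  have hcard : (A₀ ∪ A₁ ∪ A₂).card ≤ A₀.card + A₁.card + A₂.card :=
    (Finset.card_union_le _ _).trans (Nat.add_le_add_right (Finset.card_union_le _ _) _)
  have hsing : 2 * A₂.card ≤ t * (t - 1) := by
    have := two_mul_card_singular_le (p := fun i : A₂ => p i)
      (hp.comp Subtype.val_injective) hT fun i => (Finset.mem_filter.1 i.2).2.2
    rwa [Fintype.card_coe] at this
  have hall : s = 0 → 11 ≤ A₀.card + A₁.card + A₂.card := by
    intro h
    refine le_trans ?_ hcard
    rw [Finset.eq_univ_iff_forall.2 fun i => hcover i ?_]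
    · simp
    · rw [hs, totalDegree_eq_zero_iff_eq_C] at h
      rw [h, eval_C]
      intro hc
      exact hS0 (by rw [h, hc, C_0])
  have hres₀ : s + t ≤ 3 → (3 - (s + t) + 2).choose 2 ≤ A₀.card := by
    intro h
    by_contra! hlt
    obtain ⟨f, hf0, hfdeg, hf⟩ := exists_curve_through p A₀ hlt
    refine mul_ne_zero (mul_ne_zero hS0 hT0) hf0 (hcubic _ ?_ fun i => ?_)
    · rw [totalDegree_mul_of_isDomain (mul_ne_zero hS0 hT0) hf0,
        totalDegree_mul_of_isDomain hS0 hT0]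
      omega
    · by_cases hi : eval (p i) D = 0
      · rw [hST, map_mul, map_pow, mul_eq_zero, sq_eq_zero_iff] at hi
        rcases hi with hi | hi <;> simp [hi]
      · rw [map_mul, hf i (by simpa [hA₀] using hi), mul_zero]
  have hres : s ≤ 3 → (3 - s + 2).choose 2 ≤ A₀.card + A₁.card + A₂.card := by
    intro h
    by_contra! hlt
    obtain ⟨f, hf0, hfdeg, hf⟩ := exists_curve_through p _ (hcard.trans_lt hlt)
    refine mul_ne_zero hS0 hf0 (hcubic _ ?_ fun i => ?_)
    · rw [totalDegree_mul_of_isDomain hS0 hf0]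
      omega
    · by_cases hi : eval (p i) S = 0
      · rw [map_mul, hi, zero_mul]
      · rw [map_mul, hf i (hcover i hi), mul_zero]
  -- the multiplicities of the moving part
  let a : Fin 11 → ℕ := fun i => 2 * (if i ∈ A₀ then 1 else 0) + if i ∈ A₁ then 1 else 0
  have hdisj : ∀ i ∈ A₀, i ∉ A₁ := fun i h₀ h₁ =>
    (Finset.mem_filter.1 h₀).2 (Finset.mem_filter.1 h₁).2.1
  have hGa : ∀ j i, G j ∈ vanishingAt (p i) ^ a i := by
    intro j i
    have hDG := hFG j ▸ hF j i
    by_cases h₀ : i ∈ A₀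
    · simpa [a, h₀, hdisj i h₀] using
        mem_vanishingAt_pow_of_mul_mem (Finset.mem_filter.1 h₀).2 hDG
    · by_cases h₁ : i ∈ A₁
      · simp only [a, h₀, h₁, if_true, if_false, mul_zero, zero_add, pow_one]
        by_contra h
        rw [mem_vanishingAt] at h
        exact (Finset.mem_filter.1 h₁).2.2
          (mem_vanishingAt_pow_of_mul_mem h (mul_comm D (G j) ▸ hDG))
      · simp [a, h₀, h₁]
  have : Infinite k := CharZero.infinite k
  obtain ⟨c, hc⟩ := exists_isRelPrime_add_C_mul (F := G 0) (A := G 1) (B := G 2)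
    (hGLI.ne_zero 0) fun q hq h₀ h₁ h₂ => hirr q hq fun j => by fin_cases j <;> assumption
  have hbez : 4 * A₀.card + A₁.card ≤ (6 - D.totalDegree) * (6 - D.totalDegree) := by
    have h := sum_multiplicity_mul_le hp (hGLI.ne_zero 0) hc.symm (a := a) (b := a)
      (fun i => Ideal.add_mem _ (hGa 1 i) (Ideal.mul_mem_left _ _ (hGa 2 i))) (hGa 0)
    have hsum : ∑ i, a i * a i = 4 * A₀.card + A₁.card := by
      have : ∀ i, a i * a i = 4 * (if i ∈ A₀ then 1 else 0) + if i ∈ A₁ then 1 else 0 := by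
        intro i
        by_cases h₀ : i ∈ A₀
        · simp [a, h₀, hdisj i h₀]
        · by_cases h₁ : i ∈ A₁ <;> simp [a, h₀, h₁]
      simp [this, Finset.sum_add_distrib, mul_comm]
    rw [hsum] at h
    refine h.trans (Nat.mul_le_mul ((totalDegree_add _ _).trans (max_le ?_ ?_)) ?_)
    · have := hGdeg 1
      omega
    · refine (totalDegree_mul _ _).trans ?_
      have := hGdeg 2
      rw [totalDegree_C]
      omega
    · have := hGdeg 0
      omega
  have hfive : D.totalDegree = 5 → A₀.card + A₁.card = 0 := by
    intro h
    rw [← Finset.card_union_of_disjoint (Finset.disjoint_left.2 hdisj), Finset.card_eq_zero,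
      Finset.eq_empty_iff_forall_notMem]
    intro i hi
    refine not_forall_eval_eq_zero_of_linearIndependent hGLI (fun j => ?_) (p i) fun j => ?_
    · have := hGdeg j
      omega
    · refine mem_vanishingAt.1 (Ideal.pow_le_self ?_ (hGa j i))
      rcases Finset.mem_union.1 hi with h | h <;> simp [a, h]
  have hsix : D.totalDegree ≠ 6 := fun h =>
    not_forall_totalDegree_eq_zero_of_linearIndependent hGLI fun j => by
      have := hGdeg j
      omega
  have hle : D.totalDegree ≤ 6 := le_trans (Nat.le_add_right _ _) (hGdeg 0)
  rw [hDdeg] at hbez hfive hsix hle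
  exact not_numerically_admissible hsing hall hres₀ hres hbez hfive hsix hle

end AffineSextics

section Dehomogenization

variable {k : Type*} [Field k]

theorem sum_eq_of_mem_support {σ : Type*} [Fintype σ] {f : MvPolynomial σ k} {t : ℕ}
    (hf : f.IsHomogeneous t) {d : σ →₀ ℕ} (hd : d ∈ f.support) : ∑ i, d i = t := by
  rw [← Finsupp.degree_eq_sum]
  exact (congrArg (· d) Finsupp.degree_eq_weight_one).trans (hf (mem_support_iff.1 hd))

theorem eval_smul_of_isHomogeneous {σ : Type*} [Fintype σ] {f : MvPolynomial σ k} {t : ℕ}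
    (hf : f.IsHomogeneous t) (a : k) (v : σ → k) : eval (a • v) f = a ^ t * eval v f := by
  rw [eval_eq', eval_eq', Finset.mul_sum]
  refine Finset.sum_congr rfl fun d hd => ?_
  have hdeg := sum_eq_of_mem_support hf hd
  simp only [Pi.smul_apply, smul_eq_mul, mul_pow, Finset.prod_mul_distrib,
    Finset.prod_pow_eq_pow_sum, hdeg]
  ring

theorem totalDegree_aeval_le {σ τ : Type*} {g : σ → MvPolynomial τ k}
    (hg : ∀ i, (g i).totalDegree ≤ 1) (f : MvPolynomial σ k) :
    (aeval g f).totalDegree ≤ f.totalDegree := by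
  rw [aeval_def, eval₂_eq]
  refine totalDegree_finsetSum_le fun d hd => ?_
  refine (totalDegree_mul _ _).trans ?_
  rw [algebraMap_eq, totalDegree_C, zero_add]
  refine ((totalDegree_finsetProd _ _).trans (Finset.sum_le_sum fun i _ => ?_)).trans
    (le_totalDegree hd)
  exact (totalDegree_pow _ _).trans (by simpa using Nat.mul_le_mul_left (d i) (hg i))

/-- A homogeneous polynomial vanishing at `v` lies in the ideal generated by the linear forms
vanishing at `v`. -/
theorem mem_span_linear_of_eval_eq_zero {σ : Type*} [Fintype σ] {v : σ → k} (hv : v ≠ 0) {t : ℕ}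
    {f : MvPolynomial σ k} (hf : f.IsHomogeneous t) (h0 : eval v f = 0) :
    f ∈ Ideal.span {l : MvPolynomial σ k | l.IsHomogeneous 1 ∧ eval v l = 0} := by
  obtain ⟨j, hj⟩ := Function.ne_iff.1 hv
  rw [Pi.zero_apply] at hj
  set I := Ideal.span {l : MvPolynomial σ k | l.IsHomogeneous 1 ∧ eval v l = 0} with hI
  have hX : ∀ i, Ideal.Quotient.mk I (X i) =
      Ideal.Quotient.mk I (C (((v j)⁻¹ • v) i) * X j) := by
    intro i
    rw [Ideal.Quotient.eq]
    refine Ideal.subset_span ⟨(isHomogeneous_X k i).sub (isHomogeneous_C_mul_X _ j), ?_⟩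
    · simp only [map_sub, map_mul, eval_X, eval_C, Pi.smul_apply, smul_eq_mul]
      rw [mul_right_comm, inv_mul_cancel₀ hj, one_mul, sub_self]
  rw [← Ideal.Quotient.eq_zero_iff_mem]
  have hmk : Ideal.Quotient.mk I f =
      Ideal.Quotient.mk I (C (eval ((v j)⁻¹ • v) f) * X j ^ t) := by
    conv_lhs => rw [f.as_sum]
    rw [eval_eq', map_sum, map_sum C, Finset.sum_mul, map_sum]
    refine Finset.sum_congr rfl fun d hd => ?_
    have hdeg := sum_eq_of_mem_support hf hd
    rw [monomial_eq, Finsupp.prod_fintype _ _ fun i => pow_zero _, map_mul, map_prod]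
    simp only [map_pow, hX]
    simp only [map_mul, mul_pow, Finset.prod_mul_distrib, Finset.prod_pow_eq_pow_sum, hdeg,
      map_prod, map_pow]
    ring
  rw [hmk, eval_smul_of_isHomogeneous hf, h0]
  simp

/-- The value at `v` of the linear form `c ^ 2 * x + c * y + z`. -/
def lineValue (c : k) (v : Fin 3 → k) : k := v 0 * c ^ 2 + v 1 * c + v 2

theorem exists_lineValue_ne_zero [Infinite k] {ι : Type*} [Fintype ι] {v : ι → Fin 3 → k}
    (hv : ∀ i, v i ≠ 0) : ∃ c, ∀ i, lineValue c (v i) ≠ 0 := by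
  let q : ι → Polynomial k := fun i =>
    .C (v i 0) * .X ^ 2 + .C (v i 1) * .X + .C (v i 2)
  have hq : ∏ i, q i ≠ 0 := by
    refine Finset.prod_ne_zero_iff.2 fun i _ h => hv i (funext fun j => ?_)
    have hc : ∀ n, (q i).coeff n = 0 := by simp [h]
    have h0 := hc 0
    have h1 := hc 1
    have h2 := hc 2
    simp [q, Polynomial.coeff_X, Polynomial.coeff_C] at h0 h1 h2
    fin_cases j <;> simp [h0, h1, h2]
  obtain ⟨c, hc⟩ : ∃ c, (∏ i, q i).eval c ≠ 0 := by
    by_contra! h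
    exact hq (Polynomial.funext fun c => by rw [h, Polynomial.eval_zero])
  rw [Polynomial.eval_prod, Finset.prod_ne_zero_iff] at hc
  exact ⟨c, fun i => by simpa [q, lineValue] using hc i (Finset.mem_univ i)⟩

/-- Restriction of polynomials to the affine chart `c ^ 2 * x + c * y + z = 1`, with coordinates
`x` and `y`. -/
noncomputable def dehomogenize (c : k) : MvPolynomial (Fin 3) k →ₐ[k] MvPolynomial (Fin 2) k :=
  aeval ![X 0, X 1, 1 - C (c ^ 2) * X 0 - C c * X 1]

/-- The coordinates of the point `v` in the affine chart `c ^ 2 * x + c * y + z = 1`. -/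
def affinePoint (c : k) (v : Fin 3 → k) : Fin 2 → k :=
  ![(lineValue c v)⁻¹ * v 0, (lineValue c v)⁻¹ * v 1]

theorem eval_affinePoint_dehomogenize {c : k} {v : Fin 3 → k} (hv : lineValue c v ≠ 0)
    (f : MvPolynomial (Fin 3) k) :
    eval (affinePoint c v) (dehomogenize c f) = eval ((lineValue c v)⁻¹ • v) f := by
  induction f using MvPolynomial.induction_on with
  | C a => simp [dehomogenize]
  | add f g hf hg => simp only [map_add, hf, hg]
  | mul_X f i hf =>
    rw [map_mul, map_mul, map_mul, hf]
    congr 1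
    fin_cases i
    · simp [dehomogenize, affinePoint]
    · simp [dehomogenize, affinePoint]
    · simp only [dehomogenize, affinePoint, aeval_X, Fin.reduceFinMk, Matrix.cons_val, map_sub,
        map_one, map_mul, eval_C, eval_X, Pi.smul_apply, smul_eq_mul]
      field_simp
      simp only [lineValue]
      ring

theorem smul_eq_of_affinePoint_eq {c : k} {v w : Fin 3 → k} (hv : lineValue c v ≠ 0)
    (hw : lineValue c w ≠ 0) (h : affinePoint c v = affinePoint c w) :
    (lineValue c v)⁻¹ • v = (lineValue c w)⁻¹ • w := by
  funext i
  have := congrArg (fun p => eval p (dehomogenize c (X i))) h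
  simpa only [eval_affinePoint_dehomogenize hv, eval_affinePoint_dehomogenize hw, eval_X] using this

theorem totalDegree_dehomogenize_le (c : k) (f : MvPolynomial (Fin 3) k) :
    (dehomogenize c f).totalDegree ≤ f.totalDegree := by
  refine totalDegree_aeval_le (fun i => ?_) f
  have hmul : ∀ (a : k) (j : Fin 2), (C a * X j : MvPolynomial (Fin 2) k).totalDegree ≤ 1 :=
    fun a j => (totalDegree_mul _ _).trans (by simp)
  fin_cases i
  · simp
  · simp
  · exact (totalDegree_sub _ _).trans
      (max_le ((totalDegree_sub _ _).trans (max_le (by simp) (hmul _ _))) (hmul _ _))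

theorem eq_zero_of_dehomogenize_eq_zero [Infinite k] (c : k) {t : ℕ} {f : MvPolynomial (Fin 3) k}
    (hf : f.IsHomogeneous t) (h : dehomogenize c f = 0) : f = 0 := by
  have hl : (C (c ^ 2) * X 0 + C c * X 1 + X 2 : MvPolynomial (Fin 3) k) ≠ 0 := by
    intro h
    simpa using congrArg (eval ![0, 0, 1]) h
  refine (mul_eq_zero.1 (MvPolynomial.funext fun v => ?_)).resolve_right hl
  by_cases hv : lineValue c v = 0
  · rw [map_mul, map_zero]
    refine mul_eq_zero_of_right _ ?_
    rw [← hv, lineValue]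
    simp [mul_comm]
  · have h0 := eval_affinePoint_dehomogenize hv f
    rw [h, map_zero, eval_smul_of_isHomogeneous hf, eq_comm, mul_eq_zero] at h0
    rw [map_mul, h0.resolve_left (pow_ne_zero _ (inv_ne_zero hv)), zero_mul, map_zero]

theorem exists_isHomogeneous_dehomogenize_eq [Infinite k] (c : k) {t : ℕ}
    {g : MvPolynomial (Fin 2) k} (hg : g.totalDegree ≤ t) :
    ∃ f : MvPolynomial (Fin 3) k, f.IsHomogeneous t ∧ dehomogenize c f = g := by
  let φ : homogeneousSubmodule (Fin 3) k t →ₗ[k] restrictTotalDegree (Fin 2) k t :=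
    (dehomogenize c).toLinearMap.restrict fun f hf =>
      (mem_restrictTotalDegree _ _ _).2 ((totalDegree_dehomogenize_le c f).trans
        ((mem_homogeneousSubmodule t f).1 hf).totalDegree_le)
  have hφ : Function.Injective φ := by
    rw [injective_iff_map_eq_zero]
    intro f hf
    exact Subtype.ext (eq_zero_of_dehomogenize_eq_zero c ((mem_homogeneousSubmodule t _).1 f.2)
      (congrArg Subtype.val hf))
  obtain ⟨f, hf⟩ := (LinearMap.injective_iff_surjective_of_finrank_eq_finrank
    ((finrank_homogeneousSubmodule k t).trans (finrank_restrictTotalDegree k t).symm)).1 hφ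
      ⟨g, (mem_restrictTotalDegree _ _ _).2 hg⟩
  exact ⟨f, (mem_homogeneousSubmodule t _).1 f.2, congrArg Subtype.val hf⟩

end Dehomogenization

theorem map_dehomogenize_pointIdeal_le {k : Type} [Field k] {c : k}
    {P : Projectivization k (Fin 3 → k)} (hP : lineValue c P.rep ≠ 0) :
    (pointIdeal k P).map (dehomogenize c) ≤ vanishingAt (affinePoint c P.rep) := by
  rw [Ideal.map_le_iff_le_comap, pointIdeal, Ideal.span_le]
  rintro f ⟨hf, h0⟩
  rw [SetLike.mem_coe, Ideal.mem_comap, mem_vanishingAt, eval_affinePoint_dehomogenize hP,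
    eval_smul_of_isHomogeneous hf, h0, mul_zero]

/-- For 11 points of ℙ² with generic Hilbert function, H_{2X}(6) ≥ 26. -/
theorem statement5 (k : Type) [Field k] [IsAlgClosed k] [CharZero k]
    (P : Fin 11 → Projectivization k (Fin 3 → k)) (hinj : Function.Injective P)
    (hgen : HasGenericHilbertFunction k P) :
    26 ≤ hilbertFunction k (doubleIdealOfPoints k P) 6 := by
  have : Infinite k := CharZero.infinite k
  obtain ⟨c, hc⟩ := exists_lineValue_ne_zero fun i => (P i).rep_nonzero
  let p : Fin 11 → Fin 2 → k := fun i => affinePoint c (P i).rep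
  have hp : Function.Injective p := by
    intro i j hij
    have h := smul_eq_of_affinePoint_eq (hc i) (hc j) hij
    refine hinj ?_
    rw [← (P i).mk_rep, ← (P j).mk_rep, Projectivization.mk_eq_mk_iff']
    refine ⟨lineValue c (P i).rep * (lineValue c (P j).rep)⁻¹, ?_⟩
    rw [mul_smul, ← h, smul_inv_smul₀ (hc i)]
  have hbot : Submodule.restrictScalars k (idealOfPoints k P) ⊓
      homogeneousSubmodule (Fin 3) k 3 = ⊥ := by
    have h := hgen 3
    rw [hilbertFunction, finrank_homogeneousSubmodule] at h
    norm_num [Nat.choose] at h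
    have : Module.Finite k ↥(Submodule.restrictScalars k (idealOfPoints k P) ⊓
        homogeneousSubmodule (Fin 3) k 3) := Submodule.finiteDimensional_inf_right _ _
    rw [← Submodule.finrank_eq_zero (R := k)]
    omega
  have hcubic : ∀ g : MvPolynomial (Fin 2) k, g.totalDegree ≤ 3 → (∀ i, eval (p i) g = 0) →
      g = 0 := by
    intro g hg h0
    obtain ⟨f, hf, rfl⟩ := exists_isHomogeneous_dehomogenize_eq c hg
    suffices f = 0 by rw [this, map_zero]
    rw [← Submodule.mem_bot k, ← hbot]
    refine ⟨?_, (mem_homogeneousSubmodule 3 f).2 hf⟩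
    refine (Submodule.mem_iInf _).2 fun i =>
      mem_span_linear_of_eval_eq_zero (P i).rep_nonzero hf ?_
    have h := h0 i
    rw [eval_affinePoint_dehomogenize (hc i), eval_smul_of_isHomogeneous hf] at h
    exact (mul_eq_zero.1 h).resolve_left (pow_ne_zero _ (inv_ne_zero (hc i)))
  rw [hilbertFunction, finrank_homogeneousSubmodule, show Nat.choose (6 + 2) 2 = 28 from rfl]
  suffices h : ¬3 ≤ Module.finrank k ↥(Submodule.restrictScalars k (doubleIdealOfPoints k P) ⊓
      homogeneousSubmodule (Fin 3) k 6) by omega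
  intro h
  obtain ⟨f, hf⟩ := exists_linearIndependent_of_le_finrank h
  have hhom : ∀ j, (f j : MvPolynomial (Fin 3) k).IsHomogeneous 6 := fun j =>
    (mem_homogeneousSubmodule 6 _).1 (f j).2.2
  refine not_linearIndependent_of_singular hp hcubic (F := fun j => dehomogenize c (f j))
    (fun j => (totalDegree_dehomogenize_le c _).trans (hhom j).totalDegree_le) (fun j i => ?_) ?_
  · have hmem : (f j : MvPolynomial (Fin 3) k) ∈ pointIdeal k (P i) ^ 2 :=
      (Submodule.mem_iInf _).1 (f j).2.1 i
    have := Ideal.mem_map_of_mem (dehomogenize c) hmem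
    rw [Ideal.map_pow] at this
    exact Ideal.pow_right_mono (map_dehomogenize_pointIdeal_le (hc i)) 2 this
  · refine hf.map' ((dehomogenize c).toLinearMap ∘ₗ Submodule.subtype _) ?_
    rw [LinearMap.ker_eq_bot']
    exact fun g hg => Subtype.ext (eq_zero_of_dehomogenize_eq_zero c
      ((mem_homogeneousSubmodule 6 _).1 g.2.2) hg)
end

section
/- Let k be an algebraically closed field of characteristic 0, let d ≥ 1, and let V be a k-vector subspace of the space of homogeneous polynomials of degree d in k[x,y,z] with dim_k V ≥ 3 (i.e., the corresponding linear series of plane curves has projective dimension at least 2). If no non-unit polynomial divides every element of V (V has no fixed component), then V contains a nonzero squarefree element; equivalently, if every nonzero element of V is divisible by the square of some non-unit polynomial, then V has a fixed component. -/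
open MvPolynomial

/-- Over an infinite field, a linear system without fixed component contains, for each nonzero `f`,
a member that is relatively prime to `f`. -/
theorem Submodule.exists_isRelPrime_of_forall_dvd_isUnit {k R : Type*} [Field k] [Infinite k]
    [CommRing R] [IsDomain R] [UniqueFactorizationMonoid R] [Algebra k R] (V : Submodule k R)
    (hV : ∀ g : R, (∀ f ∈ V, g ∣ f) → IsUnit g) {f : R} (hf : f ≠ 0) :
    ∃ g ∈ V, IsRelPrime f g := by
  classical
  by_contra! h
  let W : R → Submodule k V := fun p =>
    ((Ideal.span {p}).restrictScalars k).comap V.subtype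
  have mem_W (p : R) (v : V) : v ∈ W p ↔ p ∣ v := by
    simp [W, Ideal.mem_span_singleton]
  let S := (UniqueFactorizationMonoid.factors f).toFinset
  have cover : ⋃ q ∈ S.image W, (q : Set V) = Set.univ := by
    refine Set.eq_univ_of_forall fun v => ?_
    have hv := h v v.2
    rw [UniqueFactorizationMonoid.isRelPrime_iff_no_prime_factors hf] at hv
    push Not at hv
    obtain ⟨p, hpf, hpv, hp⟩ := hv
    obtain ⟨q, hq, hpq⟩ := UniqueFactorizationMonoid.exists_mem_factors_of_dvd hf hp.irreducible hpf
    simp only [Set.mem_iUnion]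
    exact ⟨W q, Finset.mem_image_of_mem W (Multiset.mem_toFinset.2 hq),
      (mem_W q v).2 (hpq.symm.dvd.trans hpv)⟩
  obtain ⟨p, hp, hpt⟩ := Finset.mem_image.1 (Subspace.top_mem_of_biUnion_eq_univ cover)
  refine (UniqueFactorizationMonoid.irreducible_of_factor p (Multiset.mem_toFinset.1 hp)).not_isUnit
    (hV p fun g hg => (mem_W p ⟨g, hg⟩).1 ?_)
  rw [hpt]
  trivial

/-- If `p ^ 2` divides `f + t g` for a constant `t`, then `p` divides the Wronskian of
`f` and `g`. -/
theorem Derivation.dvd_wronskian_of_mul_self_dvd_add_smul {k R : Type*} [CommRing k] [CommRing R]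
    [Algebra k R] (D : Derivation k R R) {f g p : R} {t : k} (h : p * p ∣ f + t • g) :
    p ∣ f * D g - g * D f := by
  have hD : p ∣ D f + t • D g := by
    obtain ⟨c, hc⟩ := h
    have := congrArg D hc
    rw [map_add, D.map_smul, D.leibniz, D.leibniz] at this
    rw [this]
    simp only [smul_eq_mul]
    exact ⟨p * D c + c * (D p + D p), by ring⟩
  have h' : p ∣ f + t • g := (dvd_mul_right p p).trans h
  have key : f * D g - g * D f = (f + t • g) * D g - g * (D f + t • D g) := by
    simp only [Algebra.smul_def]
    ring
  rw [key]
  exact dvd_sub (h'.mul_right _) (hD.mul_left _)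

/-- If every member `f + t g` of a pencil without fixed component has a repeated factor, then
the Wronskian of `f` and `g` vanishes, for every derivation. -/
theorem Derivation.wronskian_eq_zero_of_forall_exists_irreducible_sq_dvd {k R : Type*} [Field k]
    [Infinite k] [CommRing R] [IsDomain R] [UniqueFactorizationMonoid R] [Algebra k R]
    (D : Derivation k R R) {f g : R} (hfg : IsRelPrime f g)
    (h : ∀ t : k, ∃ p, Irreducible p ∧ p * p ∣ f + t • g) :
    f * D g - g * D f = 0 := by
  classical
  by_contra hw
  choose p hp hpt using h
  choose q hq hpq using fun t => UniqueFactorizationMonoid.exists_mem_factors_of_dvd hw (hp t)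
    (D.dvd_wronskian_of_mul_self_dvd_add_smul (hpt t))
  have hqt (t : k) : q t ∣ f + t • g :=
    (hpq t).symm.dvd.trans ((dvd_mul_right _ _).trans (hpt t))
  have inj : Function.Injective q := by
    intro s t hst
    by_contra hne
    have hs : q t ∣ f + s • g := hst ▸ hqt s
    have hg : q t ∣ g := by
      have hsub := dvd_sub hs (hqt t)
      rw [add_sub_add_left_eq_sub, ← sub_smul] at hsub
      have := hsub.trans (dvd_of_eq (Algebra.smul_def (s - t) g))
      exact (((isUnit_iff_ne_zero.2 (sub_ne_zero.2 hne)).map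
        (algebraMap k R)).dvd_mul_left).1 this
    have hf : q t ∣ f := by
      refine (dvd_add_left ?_).1 (hqt t)
      rw [Algebra.smul_def]
      exact hg.mul_left _
    exact (UniqueFactorizationMonoid.irreducible_of_factor _ (hq t)).not_isUnit (hfg hf hg)
  let S := (UniqueFactorizationMonoid.factors (f * D g - g * D f)).toFinset
  have : Infinite S := Infinite.of_injective
    (fun t : k => (⟨q t, Multiset.mem_toFinset.2 (hq t)⟩ : S))
    fun s t hst => inj (congrArg Subtype.val hst)
  exact not_finite S

/-- A homogeneous polynomial of positive degree in characteristic zero that divides all its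
partial derivatives is zero. -/
theorem MvPolynomial.IsHomogeneous.eq_zero_of_forall_dvd_pderiv {σ k : Type*} [Fintype σ] [Field k]
    [CharZero k] {d : ℕ} (hd : d ≠ 0) {f : MvPolynomial σ k} (hf : f.IsHomogeneous d)
    (h : ∀ i, f ∣ pderiv i f) : f = 0 := by
  by_contra hf0
  have hz (i : σ) : pderiv i f = 0 := by
    by_contra hi
    have h1 := totalDegree_le_of_dvd_of_isDomain (h i) hi
    rw [hf.totalDegree hf0, (hf.pderiv (i := i)).totalDegree hi] at h1
    omega
  have euler := hf.sum_X_mul_pderiv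
  simp only [hz, mul_zero, Finset.sum_const_zero, nsmul_eq_mul] at euler
  exact mul_ne_zero (Nat.cast_ne_zero.2 hd) hf0 euler.symm

/-- A linear series of plane curves of degree d of (vector-space) dimension
at least 3 with no fixed component contains a nonzero squarefree (i.e. reduced) element. -/
theorem statement7 (k : Type) [Field k] [IsAlgClosed k] [CharZero k]
    (d : ℕ) (hd : 1 ≤ d) (V : Submodule k (MvPolynomial (Fin 3) k))
    (hhom : V ≤ homogeneousSubmodule (Fin 3) k d)
    (hdim : 3 ≤ Module.finrank k V)
    (hnofix : ∀ G : MvPolynomial (Fin 3) k, (∀ f ∈ V, G ∣ f) → IsUnit G) :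
    ∃ f ∈ V, f ≠ 0 ∧ Squarefree f := by
  have hV : V ≠ ⊥ := by
    rintro rfl
    simp at hdim
  obtain ⟨f, hf, hf0⟩ := V.exists_mem_ne_zero_of_ne_bot hV
  obtain ⟨g, hg, hfg⟩ := V.exists_isRelPrime_of_forall_dvd_isUnit hnofix hf0
  by_contra! hns
  have hirr : Irreducible (X 0 : MvPolynomial (Fin 3) k) := X_prime.irreducible
  refine hf0 (IsHomogeneous.eq_zero_of_forall_dvd_pderiv (by omega) (hhom hf) fun i => ?_)
  have hw := (pderiv (R := k) i).wronskian_eq_zero_of_forall_exists_irreducible_sq_dvd hfg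
      fun t => by
    by_contra! hsq
    have hsf := (squarefree_iff_irreducible_sq_not_dvd_of_exists_irreducible ⟨_, hirr⟩).2 hsq
    exact hns _ (V.add_mem hf (V.smul_mem t hg)) hsf.ne_zero hsf
  exact hfg.dvd_of_dvd_mul_left ⟨_, (sub_eq_zero.1 hw).symm⟩
end
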